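/- arXiv:2312.13014 — 2 statements merged into one kernel-verified Lean document; each statement's English description precedes it below -/
import Mathlib

section
/- Let A = k_p[x_1,...,x_n] be a skew polynomial ring in which every parameter p_ij is a root of unity, and let Z denote its center. Then: (1) the ozone group Oz(A) equals the subgroup of Aut(A) generated by the conjugation automorphisms η_{x_1},...,η_{x_n}; (2) the fixed subring A^{Oz(A)} equals Z; and (3) Oz(A) is abelian of order equal to rk_Z(A) = dim_{Frac(Z)}(A ⊗_Z Frac(Z)). -/
noncomputable section

/-- The **ozone group** of a `k`-algebra `A`: the group of `k`-algebra automorphisms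
of `A` that fix the center of `A` pointwise. -/
def ozoneGroup (k A : Type*) [CommSemiring k] [Semiring A] [Algebra k A] :
    Subgroup (A ≃ₐ[k] A) where
  carrier := {σ | ∀ z ∈ Subalgebra.center k A, σ z = z}
  one_mem' := fun _ _ => rfl
  mul_mem' := by
    intro σ τ hσ hτ z hz
    show σ (τ z) = z
    rw [hτ z hz, hσ z hz]
  inv_mem' := by
    intro σ hσ z hz
    show σ.symm z = z
    conv_lhs => rw [← hσ z hz]
    exact σ.symm_apply_apply z

/-- An element `a` of a ring is **normal** if `a·A = A·a`. -/
def IsNormal {A : Type*} [Mul A] (a : A) : Prop :=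
  Set.range (fun x => a * x) = Set.range (fun x => x * a)

open scoped TensorProduct

/-- The defining relations of the skew polynomial ring `k_p[x_1,...,x_n]`:
`x_j x_i = p_{ij}·x_i x_j` for `i < j`. -/
inductive SkewPolyRel (k : Type*) [Field k] (n : ℕ) (p : Fin n → Fin n → k) :
    FreeAlgebra k (Fin n) → FreeAlgebra k (Fin n) → Prop
  | rel (i j : Fin n) (hij : i < j) :
      SkewPolyRel k n p (FreeAlgebra.ι k j * FreeAlgebra.ι k i)
        (p i j • (FreeAlgebra.ι k i * FreeAlgebra.ι k j))

/-- The skew polynomial ring `k_p[x_1,...,x_n]`. -/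
abbrev SkewPoly (k : Type*) [Field k] (n : ℕ) (p : Fin n → Fin n → k) :=
  RingQuot (SkewPolyRel k n p)

/-- The generator `x_i` of `k_p[x_1,...,x_n]`. -/
def SkewPoly.X (k : Type*) [Field k] (n : ℕ) (p : Fin n → Fin n → k) (i : Fin n) :
    SkewPoly k n p :=
  RingQuot.mkAlgHom k (SkewPolyRel k n p) (FreeAlgebra.ι k i)

/-- The rank of a module `M` over a commutative (domain) `R`:
`rk_R(M) = dim_{Frac R}(Frac R ⊗_R M)`. -/
def rkMod (R M : Type*) [CommRing R] [AddCommGroup M] [Module R M] : ℕ :=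
  Module.finrank (FractionRing R) (FractionRing R ⊗[R] M)

section BasisConstruction

namespace SkewAux

variable {k : Type*} [Field k] {n : ℕ}

/-- exponent vector of a word -/
def cnt (w : List (Fin n)) : Fin n → ℕ := fun i => w.count i

/-- word with prescribed exponent vector -/
def lst (m : Fin n → ℕ) : List (Fin n) :=
  (List.finRange n).flatMap (fun i => List.replicate (m i) i)

lemma cnt_lst (m : Fin n → ℕ) : cnt (lst m) = m := by
  funext i
  simp only [cnt, lst, List.count_flatMap]
  have : (List.map (List.count i ∘ fun i => List.replicate (m i) i) (List.finRange n)).sum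
      = ∑ j : Fin n, (if j = i then m j else 0) := by
    rw [← List.sum_ofFn, List.ofFn_eq_map]
    congr 1
    apply List.map_congr_left
    intro j _
    simp [List.count_replicate]
  rw [this]
  simp

lemma cnt_append (v w : List (Fin n)) : cnt (v ++ w) = cnt v + cnt w := by
  funext i; simp [cnt]

lemma cnt_cons (i : Fin n) (w : List (Fin n)) : cnt (i :: w) = cnt w + Pi.single i 1 := by
  funext j
  simp only [cnt, List.count_cons, Pi.add_apply, Pi.single_apply]
  by_cases h : i = j
  · simp [h]
  · simp [h, Ne.symm h]

lemma perm_of_cnt {v w : List (Fin n)} (h : cnt v = cnt w) : v.Perm w := by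
  rw [List.perm_iff_count]
  intro a; exact congrFun h a

variable (p : Fin n → Fin n → k)

/-- coefficient for the action -/
def cf (i : Fin n) (m : Fin n → ℕ) : k := ∏ j, if j < i then p j i ^ m j else 1

lemma cf_ne (h0 : ∀ i j, p i j ≠ 0) (i : Fin n) (m : Fin n → ℕ) : cf p i m ≠ 0 := by
  unfold cf
  rw [Finset.prod_ne_zero_iff]
  intro j _
  split_ifs
  · exact pow_ne_zero _ (h0 _ _)
  · exact one_ne_zero

lemma cf_lt {i j : Fin n} (hij : i < j) (m : Fin n → ℕ) :
    cf p j (m + Pi.single i 1) = cf p j m * p i j := by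
  unfold cf
  rw [← Finset.mul_prod_erase _ _ (Finset.mem_univ i),
    ← Finset.mul_prod_erase Finset.univ (fun a => if a < j then p a j ^ m a else 1) (Finset.mem_univ i)]
  have : ∀ a ∈ Finset.univ.erase i, (if a < j then p a j ^ ((m + Pi.single i 1 : Fin n → ℕ) a) else 1)
      = if a < j then p a j ^ m a else 1 := by
    intro a ha
    have : a ≠ i := Finset.ne_of_mem_erase ha
    simp [Pi.single_apply, this]
  rw [Finset.prod_congr rfl this]
  simp [hij, pow_succ]
  ring

lemma cf_ge {i j : Fin n} (hij : ¬ j < i) (m : Fin n → ℕ) :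
    cf p i (m + Pi.single j 1) = cf p i m := by
  unfold cf
  apply Finset.prod_congr rfl
  intro a _
  by_cases h : a = j
  · subst h; simp [hij]
  · simp [Pi.single_apply, h]

/-- action of the generator -/
def T (i : Fin n) : ((Fin n → ℕ) →₀ k) →ₗ[k] ((Fin n → ℕ) →₀ k) :=
  Finsupp.linearCombination k (fun m => Finsupp.single (m + Pi.single i 1) (cf p i m))

lemma T_single (i : Fin n) (m : Fin n → ℕ) (a : k) :
    T p i (Finsupp.single m a) = Finsupp.single (m + Pi.single i 1) (a * cf p i m) := by
  simp [T, Finsupp.linearCombination_single]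

/-- the representation -/
def rep : SkewPoly k n p →ₐ[k] Module.End k ((Fin n → ℕ) →₀ k) :=
  RingQuot.liftAlgHom k ⟨FreeAlgebra.lift k (T p), by
    rintro _ _ ⟨i, j, hij⟩
    simp only [map_mul, map_smul, FreeAlgebra.lift_ι_apply]
    apply Finsupp.lhom_ext
    intro m a
    simp only [Module.End.mul_apply, LinearMap.smul_apply, T_single, Finsupp.smul_single]
    rw [cf_lt p hij, cf_ge p (not_lt.2 hij.le), add_right_comm]
    congr 1
    simp only [smul_eq_mul]; ring⟩

lemma rep_X (i : Fin n) : rep p (SkewPoly.X k n p i) = T p i := by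
  simp [rep, SkewPoly.X]

/-- word in the generators -/
def wd (w : List (Fin n)) : SkewPoly k n p := (w.map (SkewPoly.X k n p)).prod

lemma wd_append (v w : List (Fin n)) : wd p (v ++ w) = wd p v * wd p w := by
  simp [wd]

lemma rep_wd (h0 : ∀ i j, p i j ≠ 0) (w : List (Fin n)) :
    ∃ u : kˣ, rep p (wd p w) (Finsupp.single 0 1) = Finsupp.single (cnt w) (u : k) := by
  induction w with
  | nil => exact ⟨1, by simp [wd]; rfl⟩
  | cons i w ih =>
    obtain ⟨u, hu⟩ := ih
    refine ⟨u * Units.mk0 _ (cf_ne p h0 i (cnt w)), ?_⟩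
    have : wd p (i :: w) = SkewPoly.X k n p i * wd p w := by simp [wd]
    rw [this, map_mul, Module.End.mul_apply, hu, rep_X, T_single, cnt_cons]
    simp

variable {p}
lemma X_comm (h0 : ∀ i j, p i j ≠ 0) (hp1 : ∀ i, p i i = 1) (hp2 : ∀ i j, p j i = (p i j)⁻¹)
    (i j : Fin n) : SkewPoly.X k n p j * SkewPoly.X k n p i =
      p i j • (SkewPoly.X k n p i * SkewPoly.X k n p j) := by
  have key : ∀ i j : Fin n, i < j → SkewPoly.X k n p j * SkewPoly.X k n p i =
      p i j • (SkewPoly.X k n p i * SkewPoly.X k n p j) := by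
    intro i j hij
    have := RingQuot.mkAlgHom_rel k (SkewPolyRel.rel (k := k) (p := p) i j hij)
    simpa [SkewPoly.X] using this
  rcases lt_trichotomy i j with h | h | h
  · exact key i j h
  · subst h; simp [hp1]
  · rw [key j i h, smul_smul, hp2 j i, inv_mul_cancel₀ (h0 _ _), one_smul]

lemma wd_perm (h0 : ∀ i j, p i j ≠ 0) (hp1 : ∀ i, p i i = 1) (hp2 : ∀ i j, p j i = (p i j)⁻¹)
    {v w : List (Fin n)} (h : v.Perm w) : ∃ u : kˣ, wd p v = (u : k) • wd p w := by
  induction h with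
  | nil => exact ⟨1, by simp⟩
  | cons i _ ih =>
    obtain ⟨u, hu⟩ := ih
    refine ⟨u, ?_⟩
    simp only [wd, List.map_cons, List.prod_cons] at hu ⊢
    rw [hu, mul_smul_comm]
  | swap i j l =>
    refine ⟨Units.mk0 _ (h0 i j), ?_⟩
    simp only [wd, List.map_cons, List.prod_cons, Units.val_mk0]
    rw [← mul_assoc, ← mul_assoc, X_comm h0 hp1 hp2 i j, smul_mul_assoc]
  | trans _ _ ih1 ih2 =>
    obtain ⟨u, hu⟩ := ih1
    obtain ⟨v, hv⟩ := ih2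
    exact ⟨u * v, by rw [hu, hv, smul_smul]; simp⟩

lemma wd_cnt (h0 : ∀ i j, p i j ≠ 0) (hp1 : ∀ i, p i i = 1) (hp2 : ∀ i j, p j i = (p i j)⁻¹)
    {v w : List (Fin n)} (h : cnt v = cnt w) : ∃ u : kˣ, wd p v = (u : k) • wd p w :=
  wd_perm h0 hp1 hp2 (perm_of_cnt h)

lemma adjoin_X : Algebra.adjoin k (Set.range (SkewPoly.X k n p)) = ⊤ := by
  have h1 : Set.range (SkewPoly.X k n p) = (RingQuot.mkAlgHom k (SkewPolyRel k n p)) ''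
      Set.range (FreeAlgebra.ι k) := by
    rw [← Set.range_comp]; rfl
  rw [h1, ← AlgHom.map_adjoin, FreeAlgebra.adjoin_range_ι, Algebra.map_top]
  rw [AlgHom.range_eq_top]
  exact RingQuot.mkAlgHom_surjective k _

lemma wd_span (h0 : ∀ i j, p i j ≠ 0) (hp1 : ∀ i, p i i = 1) (hp2 : ∀ i j, p j i = (p i j)⁻¹) :
    ⊤ ≤ Submodule.span k (Set.range (fun m : Fin n → ℕ => wd p (lst m))) := by
  have h := congrArg Subalgebra.toSubmodule (adjoin_X (k := k) (n := n) (p := p))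
  rw [Algebra.adjoin_eq_span, Algebra.top_toSubmodule] at h
  rw [← h, Submodule.span_le]
  intro x hx
  have : ∃ w, x = wd p w := by
    induction hx using Submonoid.closure_induction with
    | mem x hx => obtain ⟨i, rfl⟩ := hx; exact ⟨[i], by simp [wd]⟩
    | one => exact ⟨[], by simp [wd]⟩
    | mul x y _ _ hx hy =>
      obtain ⟨v, rfl⟩ := hx
      obtain ⟨w, rfl⟩ := hy
      exact ⟨v ++ w, (wd_append p v w).symm⟩
  obtain ⟨w, rfl⟩ := this
  obtain ⟨u, hu⟩ := wd_cnt h0 hp1 hp2 (v := w) (w := lst (cnt w)) (cnt_lst _).symm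
  rw [hu]
  exact Submodule.smul_mem _ _ (Submodule.subset_span ⟨_, rfl⟩)

lemma wd_linInd (h0 : ∀ i j, p i j ≠ 0) :
    LinearIndependent k (fun m : Fin n → ℕ => wd p (lst m)) := by
  choose u hu using fun m => rep_wd p h0 (lst m)
  let f : SkewPoly k n p →ₗ[k] ((Fin n → ℕ) →₀ k) :=
    (LinearMap.applyₗ (Finsupp.single 0 1)).comp (rep p).toLinearMap
  apply LinearIndependent.of_comp f
  have h1 : LinearIndependent k (fun m : Fin n → ℕ => (Finsupp.single m 1 : (Fin n → ℕ) →₀ k)) := by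
    have := (Finsupp.basisSingleOne (R := k) (ι := Fin n → ℕ)).linearIndependent
    simpa using this
  have h2 := h1.units_smul u
  convert h2 using 1
  funext m
  have := hu m
  rw [cnt_lst] at this
  show rep p (wd p (lst m)) (Finsupp.single 0 1) = _
  rw [this]
  simp [Units.smul_def]

lemma exists_basis (h0 : ∀ i j, p i j ≠ 0) (hp1 : ∀ i, p i i = 1)
    (hp2 : ∀ i j, p j i = (p i j)⁻¹) :
    ∃ b : Module.Basis (Fin n → ℕ) k (SkewPoly k n p), b 0 = 1 ∧
      (∀ i, b (Pi.single i 1) = SkewPoly.X k n p i) ∧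
      (∀ m l, ∃ u : kˣ, b m * b l = (u : k) • b (m + l)) ∧
      (∀ m l, b l * b m = (∏ i, ∏ j, p i j ^ (m i * l j)) • (b m * b l)) := by
  refine ⟨Module.Basis.mk (wd_linInd h0) (wd_span h0 hp1 hp2), ?_, ?_, ?_, ?_⟩
  · have : lst (0 : Fin n → ℕ) = [] := by simp [lst]
    simp [this, wd]
  · intro i
    have : lst (Pi.single i 1 : Fin n → ℕ) = [i] := by
      rw [← List.perm_singleton]
      apply perm_of_cnt
      rw [cnt_lst, cnt_cons]
      funext j; simp [cnt]
    simp [this, wd]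
  · intro m l
    simp only [Module.Basis.mk_apply, ← wd_append]
    exact wd_cnt h0 hp1 hp2 (by rw [cnt_append, cnt_lst, cnt_lst, cnt_lst])
  · intro m l
    simp only [Module.Basis.mk_apply]
    have h1 : ∀ (w : List (Fin n)) (j : Fin n), SkewPoly.X k n p j * wd p w =
        (∏ i, p i j ^ (cnt w i)) • (wd p w * SkewPoly.X k n p j) := by
      intro w j
      induction w with
      | nil => simp [wd, cnt]
      | cons i w ih =>
        have : wd p (i :: w) = SkewPoly.X k n p i * wd p w := by simp [wd]
        rw [this, ← mul_assoc, X_comm h0 hp1 hp2 i j, smul_mul_assoc, mul_assoc, ih,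
          mul_smul_comm, smul_smul, mul_assoc, cnt_cons]
        congr 1
        simp only [Pi.add_apply, pow_add, Finset.prod_mul_distrib, Pi.single_apply]
        simp [Finset.prod_ite_eq, pow_ite, mul_comm]
    have h2 : ∀ v w : List (Fin n), wd p v * wd p w =
        (∏ i, ∏ j, p i j ^ (cnt w i * cnt v j)) • (wd p w * wd p v) := by
      intro v w
      induction v with
      | nil => simp [wd, cnt]
      | cons j v ih =>
        have : wd p (j :: v) = SkewPoly.X k n p j * wd p v := by simp [wd]
        rw [this, mul_assoc, ih, mul_smul_comm, ← mul_assoc, h1, smul_mul_assoc, smul_smul,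
          mul_assoc, cnt_cons]
        congr 1
        simp only [Pi.add_apply, mul_add, pow_add, Finset.prod_mul_distrib, Pi.single_apply]
        simp [pow_ite]
    have := h2 (lst l) (lst m)
    rwa [cnt_lst, cnt_lst] at this

end SkewAux

end BasisConstruction
section AbstractPart

namespace SkewAux

variable {k : Type*} [Field k] {n : ℕ}

/-- evaluate a character at an exponent -/
def ev (c : Fin n → kˣ) (m : Fin n → ℕ) : kˣ := ∏ j, c j ^ m j

/-- the character attached to a monomial -/
def bet (q : Fin n → Fin n → kˣ) (m : Fin n → ℕ) : Fin n → kˣ := fun j => ∏ i, q i j ^ m i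

lemma ev_add (c : Fin n → kˣ) (m l) : ev c (m + l) = ev c m * ev c l := by
  simp [ev, pow_add, Finset.prod_mul_distrib]

lemma ev_zero (c : Fin n → kˣ) : ev c 0 = 1 := by simp [ev]

lemma ev_one (m : Fin n → ℕ) : ev (1 : Fin n → kˣ) m = 1 := by simp [ev]

lemma ev_nsmul (c : Fin n → kˣ) (N : ℕ) (m) : ev c (N • m) = ev c m ^ N := by
  simp [ev, ← Finset.prod_pow, ← pow_mul, mul_comm]

lemma ev_mul (c d : Fin n → kˣ) (m) : ev (c * d) m = ev c m * ev d m := by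
  simp [ev, mul_pow, Finset.prod_mul_distrib]

lemma ev_inv (c : Fin n → kˣ) (m) : ev c⁻¹ m = (ev c m)⁻¹ := by
  simp [ev]

lemma ev_single (c : Fin n → kˣ) (i) : ev c (Pi.single i 1) = c i := by
  simp [ev, Pi.single_apply, pow_ite]

lemma ev_injective : Function.Injective (ev : (Fin n → kˣ) → _) := by
  intro c d h
  funext i
  rw [← ev_single c i, h, ev_single]

variable (q : Fin n → Fin n → kˣ)

lemma bet_add (m l) : bet q (m + l) = bet q m * bet q l := by
  funext j
  simp [bet, pow_add, Finset.prod_mul_distrib]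

lemma bet_zero : bet q 0 = 1 := by
  funext j
  simp [bet]

lemma bet_nsmul (N : ℕ) (m) : bet q (N • m) = bet q m ^ N := by
  funext j
  simp [bet, ← Finset.prod_pow, ← pow_mul, mul_comm]

lemma bet_single (i) : bet q (Pi.single i 1) = q i := by
  funext j
  simp [bet, Pi.single_apply, pow_ite]

lemma bet_eq_prod (m) : bet q m = ∏ i, q i ^ m i := by
  funext j; simp [bet]

lemma ev_bet_symm (hq : ∀ i j, q j i = (q i j)⁻¹) (m l) :
    ev (bet q m) l = (ev (bet q l) m)⁻¹ := by
  simp only [ev, bet, ← Finset.prod_inv_distrib, ← Finset.prod_pow]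
  rw [Finset.prod_comm]
  refine Finset.prod_congr rfl fun i _ => Finset.prod_congr rfl fun j _ => ?_
  rw [hq i j, ← pow_mul, ← pow_mul, inv_pow, inv_inv, mul_comm]

lemma bet_pow (N : ℕ) (hN : ∀ i j, q i j ^ N = 1) (m) : bet q m ^ N = 1 := by
  funext j
  simp only [bet, Pi.pow_apply, Pi.one_apply, ← Finset.prod_pow]
  refine Finset.prod_eq_one fun i _ => ?_
  rw [← pow_mul, mul_comm, pow_mul, hN, one_pow]

/-- the group of characters trivial on the exponents of central monomials -/
def DD : Set (Fin n → kˣ) := {c | ∀ m, bet q m = 1 → ev c m = 1}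

variable {q}

lemma DD_factor {N : ℕ} (hN0 : 0 < N) (hN : ∀ i j, q i j ^ N = 1) {c : Fin n → kˣ}
    (hc : c ∈ DD q) {m l} (h : bet q m = bet q l) : ev c m = ev c l := by
  obtain ⟨M, rfl⟩ : ∃ M, N = M + 1 := ⟨N - 1, by omega⟩
  have h1 : ev c (m + M • l) = 1 := hc _ (by
    rw [bet_add, bet_nsmul, h, ← pow_succ', bet_pow q _ hN])
  have h2 : ev c (l + M • l) = 1 := hc _ (by
    rw [bet_add, bet_nsmul, ← pow_succ', bet_pow q _ hN])
  rw [ev_add] at h1 h2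
  exact mul_right_cancel (h1.trans h2.symm)

lemma range_bet_sub (hq : ∀ i j, q j i = (q i j)⁻¹) : Set.range (bet q) ⊆ DD q := by
  rintro _ ⟨l, rfl⟩ m hm
  rw [ev_bet_symm q hq, hm, ev_one, inv_one]

lemma range_bet_finite {N : ℕ} (hN0 : 0 < N) (hN : ∀ i j, q i j ^ N = 1) :
    (Set.range (bet q)).Finite := by
  have : NeZero N := ⟨hN0.ne'⟩
  have h1 : ({u : kˣ | u ^ N = 1}).Finite := by
    have : Finite (rootsOfUnity N k) := inferInstance
    refine Set.Finite.subset (Set.toFinite (rootsOfUnity N k : Set kˣ)) ?_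
    intro u hu
    exact (mem_rootsOfUnity N u).2 hu
  refine Set.Finite.subset (Set.Finite.pi (fun _ : Fin n => h1)) ?_
  rintro _ ⟨m, rfl⟩ j _
  exact congrFun (bet_pow q N hN m) j

/-- character as a monoid hom -/
def evHom (c : Fin n → kˣ) : Multiplicative (Fin n → ℕ) →* k where
  toFun m := (ev c m.toAdd : k)
  map_one' := by simp [ev_zero]
  map_mul' := by intro m l; simp [ev_add]

lemma evHom_injective : Function.Injective (evHom : (Fin n → kˣ) → _) := by
  intro c d h
  apply ev_injective
  funext m
  have := DFunLike.congr_fun h (Multiplicative.ofAdd m)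
  exact Units.ext this

lemma DD_eq {N : ℕ} (hN0 : 0 < N) (hN : ∀ i j, q i j ^ N = 1) (hq : ∀ i j, q j i = (q i j)⁻¹) :
    DD q = Set.range (bet q) := by
  have hfin := range_bet_finite hN0 hN
  have : Finite (Set.range (bet q)) := hfin
  have := Fintype.ofFinite (Set.range (bet q))
  -- pull back functions
  let P : (Set.range (bet q) → k) →ₗ[k] (Multiplicative (Fin n → ℕ) → k) :=
    LinearMap.funLeft k k (fun m => (⟨bet q m.toAdd, _, rfl⟩ : Set.range (bet q)))
  have hli : LinearIndependent k (fun c : DD q => (evHom c.1 : Multiplicative (Fin n → ℕ) → k)) :=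
    (linearIndependent_monoidHom (Multiplicative (Fin n → ℕ)) k).comp
      (fun c : DD q => evHom c.1) (fun c d h => Subtype.ext (evHom_injective h))
  choose r hr using fun h : Set.range (bet q) => h.2
  have hP : ∀ c : DD q, P (fun h => (ev c.1 (r h) : k)) = evHom c.1 := by
    intro c
    funext m
    show ((ev c.1 (r ⟨bet q m.toAdd, _, rfl⟩) : kˣ) : k) = (ev c.1 m.toAdd : k)
    rw [DD_factor hN0 hN c.2 (hr _)]
  have hli2 : LinearIndependent k (fun c : DD q => (fun h => (ev c.1 (r h) : k) :
      Set.range (bet q) → k)) := by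
    apply LinearIndependent.of_comp P
    convert hli using 1
    funext c
    exact hP c
  have hf : Finite (DD q) := hli2.finite
  have hcard : Nat.card (DD q) ≤ Nat.card (Set.range (bet q)) := by
    have := Fintype.ofFinite (DD q)
    have := hli2.fintype_card_le_finrank
    rw [Module.finrank_fintype_fun_eq_card] at this
    simpa [Nat.card_eq_fintype_card] using this
  symm
  apply Set.eq_of_subset_of_ncard_le (range_bet_sub hq) hcard hf

/-- bundled hypotheses on a monomial basis -/
structure Good {A : Type*} [Ring A] [Algebra k A] (b : Module.Basis (Fin n → ℕ) k A)
    (q : Fin n → Fin n → kˣ) : Prop where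
  one : b 0 = 1
  mul : ∀ m l, ∃ u : kˣ, b m * b l = (u : k) • b (m + l)
  comm : ∀ m l, b l * b m = (ev (bet q m) l : k) • (b m * b l)
  inv : ∀ i j, q j i = (q i j)⁻¹

variable {A : Type*} [Ring A] [Algebra k A] {b : Module.Basis (Fin n → ℕ) k A}

/-- diagonal linear map -/
def dlin (b : Module.Basis (Fin n → ℕ) k A) (c : Fin n → kˣ) : A →ₗ[k] A :=
  b.constr k (fun m => (ev c m : k) • b m)

lemma dlin_b (c : Fin n → kˣ) (m) : dlin b c (b m) = (ev c m : k) • b m := by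
  simp [dlin, Module.Basis.constr_basis]

lemma dlin_mul (hg : Good b q) (c : Fin n → kˣ) (x y : A) :
    dlin b c (x * y) = dlin b c x * dlin b c y := by
  have : (LinearMap.mul k A).compr₂ (dlin b c) =
      (LinearMap.mul k A).compl₁₂ (dlin b c) (dlin b c) := by
    refine b.ext fun m => b.ext fun l => ?_
    obtain ⟨u, hu⟩ := hg.mul m l
    simp only [LinearMap.compr₂_apply, LinearMap.mul_apply', LinearMap.compl₁₂_apply, dlin_b]
    rw [hu, map_smul, dlin_b, smul_mul_smul_comm, hu, ev_add, Units.val_mul, smul_comm]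
  exact congrArg (fun f => f x y) this

lemma dlin_comp (c d : Fin n → kˣ) (x : A) : dlin b c (dlin b d x) = dlin b (c * d) x := by
  have : (dlin b c).comp (dlin b d) = dlin b (c * d) := by
    refine b.ext fun m => ?_
    simp [dlin_b, ev_mul, smul_smul, mul_comm]
  exact congrArg (fun f => f x) this

lemma dlin_one (x : A) : dlin b 1 x = x := by
  have : dlin b 1 = LinearMap.id := by
    refine b.ext fun m => ?_
    simp [dlin_b, ev_one]
  exact congrArg (fun f => f x) this

/-- diagonal automorphism -/
def diag (hg : Good b q) (c : Fin n → kˣ) : A ≃ₐ[k] A :=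
  AlgEquiv.ofLinearEquiv
    (LinearEquiv.ofLinearMap (dlin b c) (dlin b c⁻¹)
      (by ext x; simp [dlin_comp, dlin_one]) (by ext x; simp [dlin_comp, dlin_one]))
    (by show dlin b c 1 = 1; rw [← hg.one, dlin_b, ev_zero]; simp)
    (dlin_mul hg c)

lemma diag_apply (hg : Good b q) (c : Fin n → kˣ) (x : A) : diag hg c x = dlin b c x := rfl

lemma diag_b (hg : Good b q) (c : Fin n → kˣ) (m) : diag hg c (b m) = (ev c m : k) • b m :=
  dlin_b c m

lemma diag_mul (hg : Good b q) (c d : Fin n → kˣ) : diag hg (c * d) = diag hg c * diag hg d := by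
  ext x
  simp [AlgEquiv.mul_apply, diag_apply, dlin_comp]

/-- diagonal automorphisms as a hom -/
def diagHom (hg : Good b q) : (Fin n → kˣ) →* (A ≃ₐ[k] A) where
  toFun := diag hg
  map_one' := by ext x; simp [diag_apply, dlin_one]
  map_mul' := diag_mul hg

lemma diag_injective (hg : Good b q) : Function.Injective (diag hg) := by
  intro c d h
  apply ev_injective
  funext m
  have := DFunLike.congr_fun h (b m)
  rw [diag_b, diag_b] at this
  exact Units.ext (smul_left_injective k (b.ne_zero m) this)

lemma repr_dlin (c : Fin n → kˣ) (x : A) (m) : b.repr (dlin b c x) m = (ev c m : k) * b.repr x m := by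
  have : (Finsupp.lapply m).comp (b.repr.toLinearMap.comp (dlin b c)) =
      (ev c m : k) • (Finsupp.lapply m).comp b.repr.toLinearMap := by
    refine b.ext fun l => ?_
    simp only [LinearMap.comp_apply, dlin_b, LinearMap.smul_apply, LinearEquiv.coe_coe, map_smul,
      Module.Basis.repr_self, Finsupp.lapply_apply, Finsupp.single_apply]
    split_ifs with h
    · rw [h]
    · simp
  simpa using congrArg (fun f => f x) this

/-- commutation with monomials -/
lemma mul_b (hg : Good b q) (m) (x : A) : x * b m = b m * diag hg (bet q m) x := by
  have : (LinearMap.mul k A).flip (b m) =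
      (LinearMap.mul k A (b m)).comp (dlin b (bet q m)) := by
    refine b.ext fun l => ?_
    simp [dlin_b, hg.comm m l]
  exact congrArg (fun f => f x) this

/-- coefficient of a product at a unique sum -/
lemma repr_mul (hg : Good b q) (x y : A) (m l : Fin n → ℕ)
    (hu : UniqueAdd (b.repr x).support (b.repr y).support m l) :
    ∃ u : kˣ, b.repr (x * y) (m + l) = u * (b.repr x m * b.repr y l) := by
  choose u hmul using hg.mul
  refine ⟨u m l, ?_⟩
  have hx := b.linearCombination_repr x
  have hy := b.linearCombination_repr y
  rw [Finsupp.linearCombination_apply, Finsupp.sum] at hx hy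
  conv_lhs => rw [← hx, ← hy, Finset.sum_mul_sum]
  simp only [smul_mul_smul_comm, hmul, map_sum, map_smul, Module.Basis.repr_self,
    Finsupp.coe_finsetSum, Finset.sum_apply, Finsupp.smul_apply, Finsupp.single_apply, smul_eq_mul]
  rw [Finset.sum_eq_single m, Finset.sum_eq_single l]
  · simp; ring
  · intro l' hl' hne
    rw [if_neg]; · simp
    intro h; exact hne (add_left_cancel h)
  · intro h; simp [Finsupp.notMem_support_iff.1 h]
  · intro m' hm' hne
    refine Finset.sum_eq_zero fun l' hl' => ?_
    rw [if_neg]; · simp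
    intro h; exact hne (hu hm' hl' h).1
  · intro h; simp [Finsupp.notMem_support_iff.1 h]

lemma repr_ne {x : A} (hx : x ≠ 0) : (b.repr x).support.Nonempty := by
  rw [Finsupp.support_nonempty_iff]
  simpa using hx

lemma noZeroDiv (hg : Good b q) {x y : A} (hx : x ≠ 0) (hy : y ≠ 0) : x * y ≠ 0 := by
  obtain ⟨m, hm, l, hl, hu⟩ := UniqueSums.uniqueAdd_of_nonempty (repr_ne (b := b) hx)
    (repr_ne (b := b) hy)
  obtain ⟨u, hu⟩ := repr_mul hg x y m l hu
  intro h
  rw [h] at hu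
  simp at hu hm hl
  tauto

/-- factors of monomials are monomials -/
lemma factor_mono (hg : Good b q) {x y : A} {a : k} (ha : a ≠ 0) {t}
    (h : x * y = a • b t) : ∃ m, ∃ c : k, x = c • b m := by
  have h0 : x * y ≠ 0 := by rw [h]; exact smul_ne_zero ha (b.ne_zero t)
  have hx : x ≠ 0 := by rintro rfl; simp at h0
  have hy : y ≠ 0 := by rintro rfl; simp at h0
  have hxc := Finset.card_pos.2 (repr_ne (b := b) hx)
  have hyc := Finset.card_pos.2 (repr_ne (b := b) hy)
  by_cases hc : 1 < (b.repr x).support.card * (b.repr y).support.card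
  · exfalso
    obtain ⟨p1, hp1, p2, hp2, hne, hu1, hu2⟩ := TwoUniqueSums.uniqueAdd_of_one_lt_card hc
    rw [Finset.mem_product] at hp1 hp2
    have key : ∀ p : (Fin n → ℕ) × (Fin n → ℕ), p.1 ∈ (b.repr x).support →
        p.2 ∈ (b.repr y).support →
        UniqueAdd (b.repr x).support (b.repr y).support p.1 p.2 → p.1 + p.2 = t := by
      intro p h1 h2 hu
      obtain ⟨u, hu⟩ := repr_mul hg x y _ _ hu
      by_contra hcon
      rw [h] at hu
      simp [Ne.symm hcon] at hu h1 h2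
      tauto
    have e1 := key p1 hp1.1 hp1.2 hu1
    have e2 := key p2 hp2.1 hp2.2 hu2
    have := hu2 hp1.1 hp1.2 (e1.trans e2.symm)
    exact hne (Prod.ext this.1 this.2)
  · have : (b.repr x).support.card = 1 := by nlinarith
    rw [Finsupp.card_support_eq_one] at this
    obtain ⟨m, -, hm⟩ := this
    refine ⟨m, b.repr x m, ?_⟩
    apply b.repr.injective
    rw [map_smul, Module.Basis.repr_self]
    conv_lhs => rw [hm]
    simp

lemma b_pow (hg : Good b q) (m) (N : ℕ) : ∃ u : kˣ, b m ^ N = (u : k) • b (N • m) := by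
  induction N with
  | zero => exact ⟨1, by simp [hg.one]⟩
  | succ N ih =>
    obtain ⟨u, hu⟩ := ih
    obtain ⟨v, hv⟩ := hg.mul (N • m) m
    exact ⟨u * v, by rw [pow_succ, hu, smul_mul_assoc, hv, smul_smul, succ_nsmul, Units.val_mul]⟩

lemma b_central (hg : Good b q) {m} (hm : bet q m = 1) : b m ∈ Subalgebra.center k A := by
  rw [Subalgebra.mem_center_iff]
  intro x
  rw [mul_b hg, hm, diag_apply, dlin_one]

lemma center_of_supp (hg : Good b q) {x : A} (hx : ∀ m, b.repr x m ≠ 0 → bet q m = 1) :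
    x ∈ Subalgebra.center k A := by
  have h := b.linearCombination_repr x
  rw [Finsupp.linearCombination_apply, Finsupp.sum] at h
  rw [← h]
  refine Subalgebra.sum_mem _ fun m hm => Subalgebra.smul_mem _ (b_central hg (hx m ?_)) _
  simpa using hm

/-- fixed by the basic conjugations -/
lemma bet_of_fixed (hg : Good b q) {x : A}
    (hx : ∀ j, diag hg (q j) x = x) (m) (hm : b.repr x m ≠ 0) : bet q m = 1 := by
  funext j
  have h1 := congrArg (fun y => b.repr y m) (hx j)
  simp only [diag_apply, repr_dlin] at h1
  have h2 : ev (q j) m = 1 := by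
    apply Units.ext
    exact mul_right_cancel₀ hm (h1.trans (one_mul _).symm)
  rw [← bet_single q j, ev_bet_symm q hg.inv, ev_single, inv_eq_one] at h2
  exact h2

lemma fixed_of_center (hg : Good b q) {x : A} (hx : x ∈ Subalgebra.center k A) (j) :
    diag hg (q j) x = x := by
  have h := mul_b hg (Pi.single j 1) x
  rw [← (Subalgebra.mem_center_iff.1 hx) (b _), bet_single] at h
  by_contra hne
  have := noZeroDiv hg (b.ne_zero (Pi.single j 1)) (sub_ne_zero.2 hne)
  rw [mul_sub, ← h, sub_self] at this
  exact this rfl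

lemma bet_of_center (hg : Good b q) {x : A} (hx : x ∈ Subalgebra.center k A) (m)
    (hm : b.repr x m ≠ 0) : bet q m = 1 :=
  bet_of_fixed hg (fixed_of_center hg hx) m hm

lemma diag_mem (hg : Good b q) (c : Fin n → kˣ) :
    diag hg c ∈ ozoneGroup k A ↔ c ∈ DD q := by
  constructor
  · intro h m hm
    have := h (b m) (b_central hg hm)
    rw [diag_b] at this
    apply Units.ext
    exact smul_left_injective k (b.ne_zero m) (by simpa using this)
  · intro h z hz
    apply b.repr.injective
    ext m
    rw [diag_apply, repr_dlin]
    by_cases hm : b.repr z m = 0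
    · simp [hm]
    · rw [h m (bet_of_center hg hz m hm)]; simp

lemma ozone_diag (hg : Good b q) {N : ℕ} (hN0 : 0 < N) (hN : ∀ i j, q i j ^ N = 1)
    (htop : Algebra.adjoin k (Set.range fun i : Fin n => b (Pi.single i 1)) = ⊤)
    {σ : A ≃ₐ[k] A} (hσ : σ ∈ ozoneGroup k A) : ∃ c, σ = diag hg c := by
  have key : ∀ i, ∃ c : kˣ, σ (b (Pi.single i 1)) = (c : k) • b (Pi.single i 1) := by
    intro i
    have h1 : σ (b (N • Pi.single i 1)) = b (N • Pi.single i 1) := hσ _ (b_central hg (by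
      rw [bet_nsmul, bet_pow q N hN]))
    obtain ⟨u, hu⟩ := b_pow hg (Pi.single i 1) N
    have h2 : σ (b (Pi.single i 1)) ^ N = (u : k) • b (N • Pi.single i 1) := by
      rw [← map_pow, hu, map_smul, h1]
    obtain ⟨M, hM⟩ : ∃ M, N = M + 1 := ⟨N - 1, by omega⟩
    obtain ⟨m, c, hc⟩ := factor_mono hg (x := σ (b (Pi.single i 1)))
      (y := σ (b (Pi.single i 1)) ^ M) u.ne_zero (by rw [← pow_succ', ← hM]; exact h2)
    have hc0 : c ≠ 0 := by
      rintro rfl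
      rw [zero_smul] at hc
      exact b.ne_zero (Pi.single i 1) (σ.injective (by rw [hc, map_zero]))
    obtain ⟨v, hv⟩ := b_pow hg m N
    rw [hc, smul_pow, hv, smul_smul] at h2
    have h3 := congrArg (fun y => b.repr y (N • m)) h2
    have h4 : N • m = N • Pi.single i 1 := by
      by_contra hne
      simp only [map_smul, Module.Basis.repr_self, Finsupp.smul_apply, Finsupp.single_apply,
        if_neg (Ne.symm hne), if_true, smul_eq_mul, mul_one, mul_zero] at h3
      exact mul_ne_zero (pow_ne_zero _ hc0) v.ne_zero h3
    have h5 : m = Pi.single i 1 := by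
      funext j
      have := congrFun h4 j
      simp only [Pi.smul_apply, smul_eq_mul] at this
      exact Nat.eq_of_mul_eq_mul_left hN0 this
    subst h5
    exact ⟨Units.mk0 c hc0, hc⟩
  choose c hc using key
  refine ⟨c, ?_⟩
  have : (σ : A →ₐ[k] A) = (diag hg c : A →ₐ[k] A) := by
    apply AlgHom.ext_of_adjoin_eq_top htop
    rintro _ ⟨i, rfl⟩
    simp only [AlgEquiv.coe_toAlgHom, hc, diag_b, ev_single]
  exact AlgEquiv.ext fun x => DFunLike.congr_fun this x

end SkewAux

end AbstractPart
section RankPart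

namespace SkewAux

variable {k : Type*} [Field k] {n : ℕ} {q : Fin n → Fin n → kˣ}
  {A : Type*} [Ring A] [Algebra k A] {b : Module.Basis (Fin n → ℕ) k A}

lemma center_isDomain (hg : Good b q) : IsDomain (Subalgebra.center k A) := by
  have : Nontrivial A := ⟨⟨b 0, 0, b.ne_zero 0⟩⟩
  have : NoZeroDivisors A := ⟨fun {x y} h => by
    by_contra hcon
    push Not at hcon
    exact noZeroDiv hg hcon.1 hcon.2 h⟩
  have : NoZeroDivisors (Subalgebra.center k A) := inferInstance
  exact NoZeroDivisors.to_isDomain _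

lemma supp_center_mul (hg : Good b q) {z : A} (hz : z ∈ Subalgebra.center k A) (l m)
    (hm : b.repr (z * b l) m ≠ 0) : bet q m = bet q l := by
  by_contra hne
  apply hm
  have h := b.linearCombination_repr z
  rw [Finsupp.linearCombination_apply, Finsupp.sum] at h
  rw [← h, Finset.sum_mul, map_sum, Finsupp.coe_finsetSum, Finset.sum_apply]
  refine Finset.sum_eq_zero fun t ht => ?_
  obtain ⟨u, hu⟩ := hg.mul t l
  have ht1 : bet q t = 1 := bet_of_center hg hz t (by simpa using ht)
  rw [smul_mul_assoc, hu]
  simp only [map_smul, Module.Basis.repr_self, Finsupp.smul_apply, Finsupp.single_apply]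
  rw [if_neg]
  · simp
  · rintro rfl
    apply hne
    rw [bet_add, ht1, one_mul]

lemma linInd_center (hg : Good b q) (r : Set.range (bet q) → (Fin n → ℕ))
    (hr : ∀ h, bet q (r h) = h.1) :
    LinearIndependent (Subalgebra.center k A) (fun h => b (r h)) := by
  rw [linearIndependent_iff']
  intro s g hs i hi
  have key : (g i : A) * b (r i) = 0 := by
    apply b.repr.injective
    ext m
    rw [map_zero, Finsupp.zero_apply]
    by_contra hm
    have h1 := supp_center_mul hg (g i).2 _ _ hm
    have h2 := congrArg (fun y => b.repr y m) hs
    simp only [map_sum, Finsupp.coe_finsetSum, Finset.sum_apply, map_zero, Finsupp.zero_apply] at h2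
    rw [Finset.sum_eq_single i] at h2
    · exact hm h2
    · intro j hj hne
      by_contra hm'
      have h3 := supp_center_mul hg (g j).2 _ _ hm'
      rw [hr] at h1 h3
      exact hne (Subtype.ext (h3.symm.trans h1))
    · intro h; exact absurd hi h
  by_contra hne
  exact noZeroDiv hg (fun h => hne (Subtype.ext h)) (b.ne_zero _) key

lemma rk_eq (hg : Good b q) {N : ℕ} (hN0 : 0 < N) (hN : ∀ i j, q i j ^ N = 1) :
    rkMod (Subalgebra.center k A) A = Nat.card (Set.range (bet q)) := by
  have := center_isDomain hg
  have hfin := range_bet_finite hN0 hN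
  have : Finite (Set.range (bet q)) := hfin
  have := Fintype.ofFinite (Set.range (bet q))
  choose r hr using fun h : Set.range (bet q) => h.2
  let Z := Subalgebra.center k A
  let K := FractionRing Z
  let f : A →ₗ[Z] K ⊗[Z] A := TensorProduct.mk Z K A 1
  have hloc : IsLocalizedModule (nonZeroDivisors Z) f := inferInstance
  have hli : LinearIndependent K (fun h => f (b (r h))) :=
    (linInd_center hg r hr).of_isLocalizedModule K (nonZeroDivisors Z) f
  have hspan : ⊤ ≤ Submodule.span K (Set.range (fun h => f (b (r h)))) := by
    have hmem : ∀ m, f (b m) ∈ Submodule.span K (Set.range (fun h => f (b (r h)))) := by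
      intro m
      set h : Set.range (bet q) := ⟨bet q m, m, rfl⟩ with hh
      obtain ⟨M, hM⟩ : ∃ M, N = M + 1 := ⟨N - 1, by omega⟩
      have hNz : bet q (N • r h) = 1 := by rw [bet_nsmul, bet_pow q N hN]
      have hz1 : bet q (m + M • r h) = 1 := by
        rw [bet_add, bet_nsmul, hr, ← pow_succ', ← hM, bet_pow q N hN]
      let w : Z := ⟨b (N • r h), b_central hg hNz⟩
      let z : Z := ⟨b (m + M • r h), b_central hg hz1⟩
      have hw : w ≠ 0 := fun h0 => b.ne_zero (N • r h) (congrArg Subtype.val h0)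
      obtain ⟨u, hu⟩ := hg.mul (m + M • r h) (r h)
      obtain ⟨v, hv⟩ := hg.mul (N • r h) m
      have hsum : m + M • r h + r h = N • r h + m := by
        rw [hM, succ_nsmul]; abel
      rw [hsum] at hu
      let s : Z := algebraMap k Z ((v : k) * (u⁻¹ : kˣ))
      have heq : w • b m = (s * z) • b (r h) := by
        show b (N • r h) * b m = (algebraMap k A ((v : k) * (u⁻¹ : kˣ)) * b (m + M • r h)) * b (r h)
        rw [mul_assoc, hu, hv, ← Algebra.smul_def, smul_smul]
        simp
      have h2 : algebraMap Z K w • f (b m) = algebraMap Z K (s * z) • f (b (r h)) := by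
        rw [algebraMap_smul, algebraMap_smul, ← map_smul f w, ← map_smul f (s * z), heq]
      have hw' : algebraMap Z K w ≠ 0 := by
        simpa using hw
      have h3 : f (b m) = ((algebraMap Z K w)⁻¹ * algebraMap Z K (s * z)) • f (b (r h)) := by
        rw [mul_smul, ← h2, smul_smul, inv_mul_cancel₀ hw', one_smul]
      rw [h3]
      exact Submodule.smul_mem _ _ (Submodule.subset_span ⟨h, rfl⟩)
    have hmem2 : ∀ a : A, f a ∈ Submodule.span K (Set.range (fun h => f (b (r h)))) := by
      intro a
      have h := b.linearCombination_repr a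
      rw [Finsupp.linearCombination_apply, Finsupp.sum] at h
      rw [← h, map_sum]
      refine Submodule.sum_mem _ fun m _ => ?_
      have : (b.repr a m) • b m = (algebraMap k Z (b.repr a m)) • b m := by
        rw [algebraMap_smul]
      rw [this, map_smul, ← algebraMap_smul K]
      exact Submodule.smul_mem _ _ (hmem m)
    rintro x -
    induction x using TensorProduct.induction_on with
    | zero => exact Submodule.zero_mem _
    | add x y hx hy => exact Submodule.add_mem _ hx hy
    | tmul c a =>
      have : c ⊗ₜ[Z] a = c • f a := by
        simp [f, TensorProduct.smul_tmul']
      rw [this]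
      exact Submodule.smul_mem _ _ (hmem2 a)
  have := Module.finrank_eq_card_basis (Module.Basis.mk hli hspan)
  rw [Nat.card_eq_fintype_card]
  exact this

end SkewAux

end RankPart

/-- Let `A = k_p[x_1,...,x_n]` be a skew polynomial ring in which every
parameter `p_{ij}` is a root of unity, and let `Z` be its center. Then:
(1) the ozone group of `A` is the subgroup of `Aut(A)` generated by the conjugation
automorphisms `η_{x_1}, ..., η_{x_n}`;
(2) the fixed subring `A^{Oz(A)}` equals `Z`;
(3) `Oz(A)` is abelian of order `rk_Z(A)`. -/
theorem stmt14 (k : Type*) [Field k] [CharZero k] (n : ℕ) (p : Fin n → Fin n → k)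
    (hp1 : ∀ i, p i i = 1) (hp2 : ∀ i j, p j i = (p i j)⁻¹)
    (hroot : ∀ i j, ∃ m : ℕ, 0 < m ∧ p i j ^ m = 1) :
    ∃ η : Fin n → (SkewPoly k n p ≃ₐ[k] SkewPoly k n p),
      (∀ i (w : SkewPoly k n p), SkewPoly.X k n p i * η i w = w * SkewPoly.X k n p i) ∧
      ozoneGroup k (SkewPoly k n p) = Subgroup.closure (Set.range η) ∧
      (∀ a : SkewPoly k n p,
        (∀ σ ∈ ozoneGroup k (SkewPoly k n p), σ a = a) ↔
          a ∈ Subalgebra.center k (SkewPoly k n p)) ∧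
      (∀ σ ∈ ozoneGroup k (SkewPoly k n p), ∀ τ ∈ ozoneGroup k (SkewPoly k n p),
        σ * τ = τ * σ) ∧
      Nat.card ↥(ozoneGroup k (SkewPoly k n p)) =
        rkMod ↥(Subalgebra.center k (SkewPoly k n p)) (SkewPoly k n p) := by
  have h0 : ∀ i j, p i j ≠ 0 := by
    intro i j h
    obtain ⟨m, hm, h1⟩ := hroot i j
    rw [h, zero_pow hm.ne'] at h1
    exact zero_ne_one h1
  obtain ⟨b, hb0, hbX, hbm, hbc⟩ := SkewAux.exists_basis h0 hp1 hp2
  let q : Fin n → Fin n → kˣ := fun i j => Units.mk0 (p i j) (h0 i j)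
  have hg : SkewAux.Good b q := by
    refine ⟨hb0, hbm, ?_, ?_⟩
    · intro m l
      rw [hbc m l]
      congr 1
      simp only [SkewAux.ev, SkewAux.bet, Units.coe_prod, Units.val_pow_eq_pow_val, q,
        Units.val_mk0, ← Finset.prod_pow, ← pow_mul]
      rw [Finset.prod_comm]
    · intro i j
      apply Units.ext
      simp [q, hp2 i j]
  choose e he0 he using hroot
  let N := ∏ i, ∏ j, e i j
  have hN0 : 0 < N := Finset.prod_pos fun i _ => Finset.prod_pos fun j _ => he0 i j
  have hN : ∀ i j, q i j ^ N = 1 := by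
    intro i j
    have hd : e i j ∣ N := (Finset.dvd_prod_of_mem (fun j => e i j) (Finset.mem_univ j)).trans
      (Finset.dvd_prod_of_mem (fun i => ∏ j, e i j) (Finset.mem_univ i))
    obtain ⟨d, hd⟩ := hd
    apply Units.ext
    rw [hd, pow_mul]
    simp [q, he]
  have htop : Algebra.adjoin k (Set.range fun i : Fin n => b (Pi.single i 1)) = ⊤ := by
    simp only [hbX]
    exact SkewAux.adjoin_X
  have hDD := SkewAux.DD_eq hN0 hN hg.inv
  have hoz : ∀ σ, σ ∈ ozoneGroup k (SkewPoly k n p) ↔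
      ∃ m, σ = SkewAux.diag hg (SkewAux.bet q m) := by
    intro σ
    constructor
    · intro h
      obtain ⟨c, rfl⟩ := SkewAux.ozone_diag hg hN0 hN htop h
      have := (SkewAux.diag_mem hg c).1 h
      rw [hDD] at this
      obtain ⟨m, rfl⟩ := this
      exact ⟨m, rfl⟩
    · rintro ⟨m, rfl⟩
      rw [SkewAux.diag_mem, hDD]
      exact ⟨m, rfl⟩
  have hηoz : ∀ i, SkewAux.diag hg (q i) ∈ ozoneGroup k (SkewPoly k n p) := by
    intro i
    rw [hoz]
    exact ⟨Pi.single i 1, by rw [SkewAux.bet_single]⟩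
  refine ⟨fun i => SkewAux.diag hg (q i), ?_, ?_, ?_, ?_, ?_⟩
  · intro i w
    have := SkewAux.mul_b hg (Pi.single i 1) w
    rw [hbX, SkewAux.bet_single] at this
    exact this.symm
  · apply le_antisymm
    · intro σ hσ
      obtain ⟨m, rfl⟩ := (hoz σ).1 hσ
      have hH : SkewAux.bet q m ∈ (Subgroup.closure (Set.range
          (fun i => SkewAux.diag hg (q i)))).comap (SkewAux.diagHom hg) := by
        rw [SkewAux.bet_eq_prod]
        refine Subgroup.prod_mem _ fun i _ => Subgroup.pow_mem _ ?_ _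
        exact Subgroup.subset_closure ⟨i, rfl⟩
      exact hH
    · rw [Subgroup.closure_le]
      rintro _ ⟨i, rfl⟩
      exact hηoz i
  · intro a
    constructor
    · intro h
      exact SkewAux.center_of_supp hg (SkewAux.bet_of_fixed hg fun j => h _ (hηoz j))
    · intro ha σ hσ
      exact hσ a ha
  · intro σ hσ τ hτ
    obtain ⟨m, rfl⟩ := (hoz σ).1 hσ
    obtain ⟨l, rfl⟩ := (hoz τ).1 hτ
    rw [← SkewAux.diag_mul, ← SkewAux.diag_mul, mul_comm]
  · rw [SkewAux.rk_eq hg hN0 hN]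
    symm
    refine Nat.card_congr (Equiv.ofBijective
      (fun c : Set.range (SkewAux.bet q) => (⟨SkewAux.diag hg c.1, by
        obtain ⟨_, m, rfl⟩ := c
        exact (hoz _).2 ⟨m, rfl⟩⟩ : ozoneGroup k (SkewPoly k n p))) ⟨?_, ?_⟩)
    · intro c d h
      exact Subtype.ext (SkewAux.diag_injective hg (congrArg Subtype.val h))
    · rintro ⟨σ, hσ⟩
      obtain ⟨m, rfl⟩ := (hoz σ).1 hσ
      exact ⟨⟨_, m, rfl⟩, rfl⟩
end
end

section
/- Suppose k is algebraically closed of characteristic 0. Let A = k_p[x,y,z] be a skew polynomial ring in three variables in which every parameter p_ij is a root of unity, and let B be a connected ℕ-graded k-algebra (not necessarily generated in degree one). If there is a k-algebra isomorphism A[t] ≅ B[t] between polynomial extensions, then B is isomorphic to a skew polynomial ring k_q[u_1,u_2,u_3] for some multiplicatively antisymmetric matrix q. -/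
noncomputable section

noncomputable section

/-- Multiplicative antisymmetry. -/
def SkAnti {k : Type*} [Field k] {n : ℕ} (p : Fin n → Fin n → k) : Prop :=
  (∀ i, p i i = 1) ∧ ∀ i j, p i j * p j i = 1

/-- A skew-commuting system of elements. -/
def SkSys {k : Type*} [Field k] {n : ℕ} (p : Fin n → Fin n → k) {S : Type*} [Ring S] [Algebra k S]
    (X : Fin n → S) : Prop :=
  ∀ i j, X j * X i = p i j • (X i * X j)

section P1
variable {k : Type*} [Field k] {n : ℕ} {p : Fin n → Fin n → k}

def sgen (p : Fin n → Fin n → k) (i : Fin n) : SkewPoly k n p :=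
  RingQuot.mkAlgHom k (SkewPolyRel k n p) (FreeAlgebra.ι k i)

theorem SkAnti.ne (h : SkAnti p) (i j) : p i j ≠ 0 := left_ne_zero_of_mul_eq_one (h.2 i j)

theorem sgen_lt {i j : Fin n} (h : i < j) :
    sgen p j * sgen p i = p i j • (sgen p i * sgen p j) := by
  have := RingQuot.mkAlgHom_rel k (SkewPolyRel.rel (k := k) (p := p) i j h)
  simpa [sgen] using this

theorem sgen_sys (hp : SkAnti p) : SkSys p (sgen p) := by
  intro i j
  rcases lt_trichotomy i j with h | h | h
  · exact sgen_lt h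
  · subst h; simp [hp.1]
  · rw [sgen_lt h, smul_smul, hp.2, one_smul]

def slift {S : Type*} [Ring S] [Algebra k S] (X : Fin n → S) (hX : SkSys p X) :
    SkewPoly k n p →ₐ[k] S :=
  RingQuot.liftAlgHom k ⟨FreeAlgebra.lift k X, by
    rintro _ _ ⟨i, j, h⟩
    simpa using hX i j⟩

@[simp] theorem slift_gen {S : Type*} [Ring S] [Algebra k S] (X : Fin n → S) (hX : SkSys p X) (i) :
    slift X hX (sgen p i) = X i := by
  simp [slift, sgen]

theorem shom_ext {S : Type*} [Ring S] [Algebra k S] {f g : SkewPoly k n p →ₐ[k] S}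
    (h : ∀ i, f (sgen p i) = g (sgen p i)) : f = g := by
  apply RingQuot.ringQuot_ext'
  ext i
  exact h i

theorem sgen_adjoin : Algebra.adjoin k (Set.range (sgen p)) = ⊤ := by
  have h1 : Algebra.adjoin k (Set.range (FreeAlgebra.ι k (X := Fin n))) = ⊤ :=
    FreeAlgebra.adjoin_range_ι k _
  have h2 := congrArg (Subalgebra.map (RingQuot.mkAlgHom k (SkewPolyRel k n p))) h1
  rw [AlgHom.map_adjoin, ← Set.range_comp, Algebra.map_top,
    (AlgHom.range_eq_top _).2 (RingQuot.mkAlgHom_surjective k _)] at h2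
  exact h2

/-! ### the monomial model -/

abbrev SkM (k : Type*) [Field k] (n : ℕ) := (Fin n →₀ ℕ) →₀ k

def skc (p : Fin n → Fin n → k) (i : Fin n) (a : Fin n →₀ ℕ) : k :=
  ∏ j ∈ Finset.univ.filter (fun j => j < i), p j i ^ a j

def skT (p : Fin n → Fin n → k) (i : Fin n) : Module.End k (SkM k n) :=
  Finsupp.lsum k fun a => (skc p i a) • Finsupp.lsingle (a + Finsupp.single i 1)

theorem skT_single (i : Fin n) (a : Fin n →₀ ℕ) (c : k) :
    skT p i (Finsupp.single a c) = Finsupp.single (a + Finsupp.single i 1) (skc p i a * c) := by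
  simp [skT]

theorem skc_ne (hp : SkAnti p) (i a) : skc p i a ≠ 0 :=
  Finset.prod_ne_zero_iff.2 fun j _ => pow_ne_zero _ (hp.ne _ _)

theorem skc_lt {i j : Fin n} (h : i < j) (a) :
    skc p j (a + Finsupp.single i 1) = p i j * skc p j a := by
  simp only [skc, Finsupp.add_apply, pow_add, Finset.prod_mul_distrib]
  rw [mul_comm]
  congr 1
  rw [Finset.prod_eq_single i]
  · simp
  · intro b _ hb; simp [Finsupp.single_apply, hb.symm]
  · simp [h]

theorem skc_gt {i j : Fin n} (h : i < j) (a) :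
    skc p i (a + Finsupp.single j 1) = skc p i a := by
  simp only [skc]
  apply Finset.prod_congr rfl
  intro b hb
  have : b < i := by simpa using hb
  have hne : j ≠ b := (this.trans h).ne'
  simp [Finsupp.single_apply, hne]

theorem skT_lt {i j : Fin n} (h : i < j) : skT p j * skT p i = p i j • (skT p i * skT p j) := by
  apply Finsupp.lhom_ext
  intro a c
  simp only [Module.End.mul_apply, skT_single, LinearMap.smul_apply, Finsupp.smul_single, smul_eq_mul]
  rw [skc_lt h, skc_gt h, add_right_comm]
  congr 1
  ring

theorem skT_sys (hp : SkAnti p) : SkSys p (skT p) := by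
  intro i j
  rcases lt_trichotomy i j with h | h | h
  · exact skT_lt h
  · subst h; simp [hp.1]
  · rw [skT_lt h, smul_smul, hp.2, one_smul]

def skRho (hp : SkAnti p) : SkewPoly k n p →ₐ[k] Module.End k (SkM k n) := slift _ (skT_sys hp)

def skEv (hp : SkAnti p) : SkewPoly k n p →ₗ[k] SkM k n where
  toFun r := skRho hp r (Finsupp.single 0 1)
  map_add' := by intros; simp
  map_smul' := by intros; simp

theorem skEv_gen_mul (hp : SkAnti p) (i r) : skEv hp (sgen p i * r) = skT p i (skEv hp r) := by
  simp [skEv, skRho]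

theorem skEv_mul (hp : SkAnti p) (s r) : skEv hp (s * r) = skRho hp s (skEv hp r) := by
  simp [skEv]

theorem skEv_one (hp : SkAnti p) : skEv hp 1 = Finsupp.single 0 1 := by
  simp [skEv]

/-- ordered monomials -/
def smonL (p : Fin n → Fin n → k) (l : List (Fin n)) (a : Fin n →₀ ℕ) : SkewPoly k n p :=
  (l.map fun j => sgen p j ^ a j).prod

theorem sgen_mul_pow (hp : SkAnti p) (i j : Fin n) (m : ℕ) :
    ∃ c : k, sgen p i * sgen p j ^ m = c • (sgen p j ^ m * sgen p i) := by
  induction m with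
  | zero => exact ⟨1, by simp⟩
  | succ m ih =>
    obtain ⟨c, hc⟩ := ih
    refine ⟨c * p j i, ?_⟩
    rw [pow_succ, ← mul_assoc, hc, smul_mul_assoc, mul_assoc, sgen_sys hp j i, mul_smul_comm,
      smul_smul, mul_assoc]

theorem smonL_mul (hp : SkAnti p) (i : Fin n) (a) (l : List (Fin n)) (hl : l.Nodup) (hi : i ∈ l) :
    ∃ c : k, sgen p i * smonL p l a = c • smonL p l (a + Finsupp.single i 1) := by
  induction l with
  | nil => simp at hi
  | cons j l ih =>
    rw [List.nodup_cons] at hl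
    by_cases hij : i = j
    · subst hij
      refine ⟨1, ?_⟩
      have : smonL p l (a + Finsupp.single i 1) = smonL p l a := by
        unfold smonL
        congr 1
        apply List.map_congr_left
        intro b hb
        have : i ≠ b := fun h => hl.1 (h ▸ hb)
        simp [Finsupp.single_apply, this]
      have h2 : ∀ a, smonL p (i :: l) a = sgen p i ^ a i * smonL p l a := fun a => by simp [smonL]
      rw [h2, h2, this]
      simp [pow_succ', mul_assoc]
    · have hi' : i ∈ l := by simpa [hij] using hi
      obtain ⟨c, hc⟩ := ih hl.2 hi'
      obtain ⟨d, hd⟩ := sgen_mul_pow hp i j (a j)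
      have h2 : ∀ a, smonL p (j :: l) a = sgen p j ^ a j * smonL p l a := fun a => by simp [smonL]
      refine ⟨d * c, ?_⟩
      rw [h2, h2, ← mul_assoc, hd, smul_mul_assoc, mul_assoc, hc, mul_smul_comm, smul_smul]
      simp [Finsupp.single_apply, hij]

def smon (p : Fin n → Fin n → k) (a : Fin n →₀ ℕ) : SkewPoly k n p := smonL p (List.finRange n) a

theorem smon_mul (hp : SkAnti p) (i : Fin n) (a) :
    ∃ c : k, sgen p i * smon p a = c • smon p (a + Finsupp.single i 1) :=
  smonL_mul hp i a _ (List.nodup_finRange n) (List.mem_finRange i)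

theorem smon_zero : smon p 0 = 1 := by
  unfold smon smonL
  apply List.prod_eq_one
  simp

theorem skRho_span (hp : SkAnti p) (r s : SkewPoly k n p) 
    (hs : s ∈ Submodule.span k (Set.range (smon p))) :
    r * s ∈ Submodule.span k (Set.range (smon p)) := by
  have hr : r ∈ Algebra.adjoin k (Set.range (sgen p)) := by rw [sgen_adjoin]; trivial
  induction hr using Algebra.adjoin_induction generalizing s with
  | mem x hx =>
    obtain ⟨i, rfl⟩ := hx
    induction hs using Submodule.span_induction with
    | mem x hx =>
      obtain ⟨a, rfl⟩ := hx
      obtain ⟨c, hc⟩ := smon_mul hp i a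
      rw [hc]
      exact Submodule.smul_mem _ _ (Submodule.subset_span ⟨_, rfl⟩)
    | zero => simp
    | add x y _ _ h1 h2 => rw [mul_add]; exact add_mem h1 h2
    | smul c x _ h => rw [mul_smul_comm]; exact Submodule.smul_mem _ _ h
  | algebraMap c => rw [← Algebra.smul_def]; exact Submodule.smul_mem _ _ hs
  | add x y _ _ h1 h2 => rw [add_mul]; exact add_mem (h1 _ hs) (h2 _ hs)
  | mul x y _ _ h1 h2 => rw [mul_assoc]; exact h1 _ (h2 _ hs)

theorem smon_span (hp : SkAnti p) : Submodule.span k (Set.range (smon p)) = ⊤ := by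
  rw [eq_top_iff]
  intro r _
  rw [← mul_one r]
  exact skRho_span hp r 1 (Submodule.subset_span ⟨0, smon_zero⟩)

theorem skT_pow (hp : SkAnti p) (i : Fin n) (m : ℕ) (a : Fin n →₀ ℕ) (c : k) (hc : c ≠ 0) :
    ∃ c' : k, c' ≠ 0 ∧ (skT p i ^ m) (Finsupp.single a c) =
      Finsupp.single (a + Finsupp.single i m) c' := by
  induction m with
  | zero => exact ⟨c, hc, by simp⟩
  | succ m ih =>
    obtain ⟨c', h1, h2⟩ := ih
    refine ⟨_, mul_ne_zero (skc_ne hp i (a + Finsupp.single i m)) h1, ?_⟩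
    rw [pow_succ', Module.End.mul_apply, h2, skT_single]
    congr 1
    rw [add_assoc, ← Finsupp.single_add]

theorem skEv_smonL (hp : SkAnti p) (a : Fin n →₀ ℕ) (l : List (Fin n)) :
    ∃ c : k, c ≠ 0 ∧ skEv hp (smonL p l a) =
      Finsupp.single (l.map fun j => Finsupp.single j (a j)).sum c := by
  induction l with
  | nil => exact ⟨1, one_ne_zero, by simp [smonL, skEv_one]⟩
  | cons j l ih =>
    obtain ⟨c, h1, h2⟩ := ih
    have h3 : smonL p (j :: l) a = sgen p j ^ a j * smonL p l a := by simp [smonL]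
    obtain ⟨c', h4, h5⟩ := skT_pow hp j (a j) ((l.map fun j => Finsupp.single j (a j)).sum) c h1
    refine ⟨c', h4, ?_⟩
    rw [h3, skEv_mul, map_pow, h2]
    have : skRho hp (sgen p j) = skT p j := by simp [skRho]
    rw [this, h5, List.map_cons, List.sum_cons, add_comm]

theorem skEv_smon (hp : SkAnti p) (a : Fin n →₀ ℕ) :
    ∃ c : k, c ≠ 0 ∧ skEv hp (smon p a) = Finsupp.single a c := by
  obtain ⟨c, h1, h2⟩ := skEv_smonL hp a (List.finRange n)
  refine ⟨c, h1, h2.trans ?_⟩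
  congr 1
  rw [← List.ofFn_eq_map, List.sum_ofFn]
  exact Finsupp.univ_sum_single a

theorem skEv_bij (hp : SkAnti p) : Function.Bijective (skEv hp) := by
  choose c h1 h2 using skEv_smon hp
  have hlin : LinearIndependent k (fun a => skEv hp (smon p a)) := by
    have : (fun a => skEv hp (smon p a)) = fun a => (Units.mk0 (c a) (h1 a)) • (Finsupp.single a (1:k)) := by
      funext a; rw [h2]; simp [Units.smul_def]
    rw [this]
    exact (Finsupp.linearIndependent_single_one k _).units_smul (fun a => Units.mk0 (c a) (h1 a))
  constructor
  · rw [injective_iff_map_eq_zero]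
    intro r hr
    have hr' : r ∈ Submodule.span k (Set.range (smon p)) := by rw [smon_span hp]; trivial
    obtain ⟨v, rfl⟩ := (Finsupp.mem_span_range_iff_exists_finsupp).1 hr'
    have : v = 0 := by
      rw [linearIndependent_iff] at hlin
      apply hlin
      rw [Finsupp.linearCombination_apply]
      rw [Finsupp.sum, map_sum] at hr
      simpa [Finsupp.sum] using hr
    simp [this]
  · intro u
    induction u using Finsupp.induction_linear with
    | zero => exact ⟨0, map_zero _⟩
    | add f g hf hg =>
      obtain ⟨a, rfl⟩ := hf; obtain ⟨b, rfl⟩ := hg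
      exact ⟨a + b, map_add _ _ _⟩
    | single a b =>
      refine ⟨(b * (c a)⁻¹) • smon p a, ?_⟩
      rw [map_smul, h2, Finsupp.smul_single, smul_eq_mul, mul_assoc, inv_mul_cancel₀ (h1 a), mul_one]

end P1
end

noncomputable section

/-- `m` is the kernel of an augmentation. -/
structure SkAug {k : Type*} [Field k] {R : Type*} [Ring R] [Algebra k R] (m : Submodule k R) :
    Prop where
  ex : ∀ r : R, ∃ c : k, r - algebraMap k R c ∈ m
  mul_left : ∀ (r : R) {a : R}, a ∈ m → r * a ∈ m
  mul_right : ∀ (r : R) {a : R}, a ∈ m → a * r ∈ m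
  one_notMem : (1 : R) ∉ m

/-- The adic filtration. -/
def skF {k : Type*} [Field k] {R : Type*} [Ring R] [Algebra k R] (m : Submodule k R) :
    ℕ → Submodule k R
  | 0 => ⊤
  | j + 1 => skF m j * m

section P2
variable {k : Type*} [Field k] {R : Type*} [Ring R] [Algebra k R] {m : Submodule k R}

theorem skF_mul_left (hm : SkAug m) (j : ℕ) (r : R) {a : R} (ha : a ∈ skF m j) :
    r * a ∈ skF m j := by
  induction j generalizing a with
  | zero => trivial
  | succ j ih =>
    induction ha using Submodule.mul_induction_on' with
    | mem_mul_mem x hx y hy => rw [← mul_assoc]; exact Submodule.mul_mem_mul (ih hx) hy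
    | add x _ y _ hx hy => rw [mul_add]; exact add_mem hx hy

theorem skF_mul_right (hm : SkAug m) (j : ℕ) (r : R) {a : R} (ha : a ∈ skF m j) :
    a * r ∈ skF m j := by
  cases j with
  | zero => trivial
  | succ j =>
    induction ha using Submodule.mul_induction_on' with
    | mem_mul_mem x hx y hy =>
      rw [mul_assoc]; exact Submodule.mul_mem_mul hx (hm.mul_right _ hy)
    | add x _ y _ hx hy => rw [add_mul]; exact add_mem hx hy

theorem skF_succ_le (hm : SkAug m) (j : ℕ) : skF m (j + 1) ≤ skF m j :=
  Submodule.mul_le.2 fun _ hx y _ => skF_mul_right hm j y hx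

theorem skF_anti (hm : SkAug m) : Antitone (skF m) := antitone_nat_of_succ_le (skF_succ_le hm)

theorem skF_one (hm : SkAug m) : skF m 1 = m := by
  apply le_antisymm
  · exact Submodule.mul_le.2 fun r _ y hy => hm.mul_left r hy
  · intro a ha
    rw [← one_mul a]
    exact Submodule.mul_mem_mul trivial ha

theorem skF_mul (hm : SkAug m) {i j : ℕ} {a b : R} (ha : a ∈ skF m i) (hb : b ∈ skF m j) :
    a * b ∈ skF m (i + j) := by
  induction j generalizing b with
  | zero => exact skF_mul_right hm i b ha
  | succ j ih =>
    induction hb using Submodule.mul_induction_on' with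
    | mem_mul_mem x hx y hy =>
      rw [← mul_assoc]; exact Submodule.mul_mem_mul (ih hx) hy
    | add x _ y _ hx hy => rw [mul_add]; exact add_mem hx hy

theorem skF_mul' (hm : SkAug m) {i j l : ℕ} (h : l ≤ i + j) {a b : R} (ha : a ∈ skF m i)
    (hb : b ∈ skF m j) : a * b ∈ skF m l := skF_anti hm h (skF_mul hm ha hb)

variable {n : ℕ} {X : Fin n → R}

theorem skV_le (hX : ∀ a, X a ∈ m) : Submodule.span k (Set.range X) ≤ m :=
  Submodule.span_le.2 (by rintro _ ⟨a, rfl⟩; exact hX a)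

theorem skV_pow_le (hm : SkAug m) (hX : ∀ a, X a ∈ m) (j : ℕ) :
    Submodule.span k (Set.range X) ^ j ≤ skF m j := by
  induction j with
  | zero => exact le_top
  | succ j ih => rw [pow_succ]; exact mul_le_mul' ih (skV_le hX)

theorem sk_ind (hX' : Algebra.adjoin k (Set.range X) = ⊤) {P : R → Prop}
    (h1 : ∀ a, P (X a)) (h2 : ∀ c : k, P (algebraMap k R c)) (h3 : ∀ a b, P a → P b → P (a + b))
    (h4 : ∀ a b, P a → P b → P (a * b)) (r : R) : P r := by
  have hr : r ∈ Algebra.adjoin k (Set.range X) := by rw [hX']; trivial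
  induction hr using Algebra.adjoin_induction with
  | mem x hx => obtain ⟨a, rfl⟩ := hx; exact h1 a
  | algebraMap c => exact h2 c
  | add x y _ _ hx hy => exact h3 _ _ hx hy
  | mul x y _ _ hx hy => exact h4 _ _ hx hy

theorem sk_m_le (hm : SkAug m) (hX : ∀ a, X a ∈ m) (hX' : Algebra.adjoin k (Set.range X) = ⊤) :
    m ≤ Submodule.span k (Set.range X) ⊔ skF m 2 := by
  have key : ∀ r : R, ∃ c : k, ∃ v ∈ Submodule.span k (Set.range X), ∃ w ∈ skF m 2,
      r = algebraMap k R c + v + w := by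
    refine sk_ind (P := fun r => ∃ c : k, ∃ v ∈ Submodule.span k (Set.range X), ∃ w ∈ skF m 2,
      r = algebraMap k R c + v + w) hX' ?_ ?_ ?_ ?_
    · exact fun a => ⟨0, X a, Submodule.subset_span ⟨a, rfl⟩, 0, zero_mem _, by simp⟩
    · exact fun c => ⟨c, 0, zero_mem _, 0, zero_mem _, by simp⟩
    · rintro _ _ ⟨c, v, hv, w, hw, rfl⟩ ⟨c', v', hv', w', hw', rfl⟩
      exact ⟨c + c', v + v', add_mem hv hv', w + w', add_mem hw hw', by rw [map_add]; abel⟩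
    · rintro _ _ ⟨c, v, hv, w, hw, rfl⟩ ⟨c', v', hv', w', hw', rfl⟩
      refine ⟨c * c', c • v' + c' • v, add_mem (Submodule.smul_mem _ _ hv')
        (Submodule.smul_mem _ _ hv), v * v' + (algebraMap k R c + v) * w' +
          w * (algebraMap k R c' + v' + w'), ?_, ?_⟩
      · refine add_mem (add_mem ?_ (skF_mul_left hm 2 _ hw')) (skF_mul_right hm 2 _ hw)
        have h1 := skF_one hm
        exact skF_mul hm (i := 1) (j := 1) (h1.ge (skV_le hX hv)) (h1.ge (skV_le hX hv'))
      · rw [map_mul, Algebra.smul_def, Algebra.smul_def, Algebra.commutes c' v]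
        noncomm_ring
  intro r hr
  obtain ⟨c, v, hv, w, hw, rfl⟩ := key r
  have hvm := skV_le hX hv
  have hwm : w ∈ m := skF_one hm ▸ skF_succ_le hm 1 hw
  have hc : algebraMap k R c ∈ m := by
    have := sub_mem (sub_mem hr hwm) hvm
    simpa using this
  have : c = 0 := by
    by_contra h0
    apply hm.one_notMem
    have := hm.mul_left (algebraMap k R c⁻¹) hc
    rwa [← map_mul, inv_mul_cancel₀ h0, map_one] at this
  subst this
  rw [map_zero, zero_add]
  exact Submodule.add_mem_sup hv hw

theorem skF_le (hm : SkAug m) (hX : ∀ a, X a ∈ m) (hX' : Algebra.adjoin k (Set.range X) = ⊤)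
    (j : ℕ) (hj : 1 ≤ j) : skF m j ≤ Submodule.span k (Set.range X) ^ j ⊔ skF m (j + 1) := by
  have h1 := skF_one hm
  induction j, hj using Nat.le_induction with
  | base => rw [h1, pow_one]; exact sk_m_le hm hX hX'
  | succ j hj ih =>
    refine Submodule.mul_le.2 fun a ha b hb => ?_
    obtain ⟨v, hv, w, hw, rfl⟩ := Submodule.mem_sup.1 (ih ha)
    obtain ⟨v', hv', w', hw', rfl⟩ := Submodule.mem_sup.1 (sk_m_le hm hX hX' hb)
    have e : (v + w) * (v' + w') = v * v' + (v * w' + w * (v' + w')) := by noncomm_ring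
    rw [e]
    refine Submodule.add_mem_sup (by rw [pow_succ]; exact Submodule.mul_mem_mul hv hv') ?_
    refine add_mem (skF_mul' hm (by omega) (skV_pow_le hm hX j hv) hw') ?_
    exact skF_mul' hm (i := j + 1) (j := 1) (by omega) hw (h1.symm ▸ hb)

/-! the filtration on the skew polynomial ring -/
variable {p : Fin n → Fin n → k}

theorem skSys_zero (p : Fin n → Fin n → k) : SkSys p (fun _ => (0 : k)) := by
  intro i j; simp

def sAug (p : Fin n → Fin n → k) : SkewPoly k n p →ₐ[k] k := slift _ (skSys_zero p)

theorem sAug_gen (i) : sAug p (sgen p i) = 0 := by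
  rw [sAug, slift_gen]

def sM (p : Fin n → Fin n → k) : Submodule k (SkewPoly k n p) := LinearMap.ker (sAug p).toLinearMap

theorem mem_sM (r) : r ∈ sM p ↔ sAug p r = 0 := by simp [sM]

theorem sM_aug : SkAug (sM p) where
  ex r := ⟨sAug p r, by simp [mem_sM]⟩
  mul_left r a ha := by rw [mem_sM] at *; simp [ha]
  mul_right r a ha := by rw [mem_sM] at *; simp [ha]
  one_notMem := by simp [mem_sM]

theorem sgen_mem (i) : sgen p i ∈ sM p := by simp [mem_sM, sAug_gen]

def skGe (k : Type*) [Field k] (n : ℕ) (j : ℕ) : Submodule k (SkM k n) :=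
  Finsupp.supported k k {a | j ≤ a.degree}

def skEq (k : Type*) [Field k] (n : ℕ) (j : ℕ) : Submodule k (SkM k n) :=
  Finsupp.supported k k {a | a.degree = j}

theorem skT_ge (i : Fin n) (j : ℕ) {u} (hu : u ∈ skGe k n j) : skT p i u ∈ skGe k n (j + 1) := by
  have : skGe k n j ≤ (skGe k n (j + 1)).comap (skT p i) := by
    unfold skGe
    rw [Finsupp.supported_eq_span_single, Submodule.span_le]
    rintro _ ⟨a, ha, rfl⟩
    simp only [SetLike.mem_coe, Submodule.mem_comap, skT_single]
    apply Finsupp.single_mem_supported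
    simpa using ha
  exact this hu

theorem skT_eq (i : Fin n) (j : ℕ) {u} (hu : u ∈ skEq k n j) : skT p i u ∈ skEq k n (j + 1) := by
  have : skEq k n j ≤ (skEq k n (j + 1)).comap (skT p i) := by
    unfold skEq
    rw [Finsupp.supported_eq_span_single, Submodule.span_le]
    rintro _ ⟨a, ha, rfl⟩
    simp only [SetLike.mem_coe, Submodule.mem_comap, skT_single]
    apply Finsupp.single_mem_supported
    simpa using ha
  exact this hu

theorem skGe_le {i j : ℕ} (h : i ≤ j) : skGe k n j ≤ skGe k n i :=
  Finsupp.supported_mono fun _ ha => h.trans ha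

theorem skRho_ge (hp : SkAnti p) (r : SkewPoly k n p) : ∀ (j : ℕ) (u), u ∈ skGe k n j →
    skRho hp r u - sAug p r • u ∈ skGe k n (j + 1) := by
  refine sk_ind (P := fun r => ∀ (j : ℕ) (u), u ∈ skGe k n j →
    skRho hp r u - sAug p r • u ∈ skGe k n (j + 1)) (sgen_adjoin (p := p)) ?_ ?_ ?_ ?_ r
  · intro i j u hu
    simp only [skRho, slift_gen, sAug_gen, zero_smul, sub_zero]
    exact skT_ge i j hu
  · intro c j u hu
    simp [Algebra.algebraMap_eq_smul_one]
  · intro a b ha hb j u hu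
    have := add_mem (ha j u hu) (hb j u hu)
    simp only [map_add, LinearMap.add_apply, add_smul]
    convert this using 1
    abel
  · intro a b ha hb j u hu
    have h1 := hb j u hu
    have h2 : skRho hp b u ∈ skGe k n j := by
      have := add_mem (skGe_le (Nat.le_succ j) h1) (Submodule.smul_mem _ (sAug p b) hu)
      simpa using this
    have := add_mem (ha j _ h2) (Submodule.smul_mem _ (sAug p a) h1)
    simp only [map_mul, Module.End.mul_apply]
    convert this using 1
    rw [smul_sub, smul_smul]
    abel

theorem skEv_F (hp : SkAnti p) (j : ℕ) {r} (hr : r ∈ skF (sM p) j) (l) (u) (hu : u ∈ skGe k n l) :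
    skRho hp r u ∈ skGe k n (l + j) := by
  induction j generalizing r l u with
  | zero => 
    have := add_mem (skGe_le (Nat.le_succ _) (skRho_ge hp r l u hu)) (Submodule.smul_mem _ (sAug p r) hu)
    simpa using this
  | succ j ih =>
    induction hr using Submodule.mul_induction_on' with
    | mem_mul_mem x hx y hy =>
      rw [map_mul, Module.End.mul_apply]
      have h1 := skRho_ge hp y l u hu
      rw [(mem_sM y).1 hy, zero_smul, sub_zero] at h1
      have := ih hx _ _ h1
      rwa [show l + (j + 1) = l + 1 + j by omega]
    | add x _ y _ hx hy => rw [map_add, LinearMap.add_apply]; exact add_mem hx hy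

theorem sk_zero_ge : (Finsupp.single 0 1 : SkM k n) ∈ skGe k n 0 :=
  Finsupp.single_mem_supported _ _ (by simp)

theorem skEv_mem (hp : SkAnti p) (j : ℕ) {r} (hr : r ∈ skF (sM p) j) : skEv hp r ∈ skGe k n j := by
  have := skEv_F hp j hr 0 _ sk_zero_ge
  rwa [zero_add] at this

theorem skEv_V (hp : SkAnti p) (j : ℕ) {r} 
    (hr : r ∈ Submodule.span k (Set.range (sgen p)) ^ j) : skEv hp r ∈ skEq k n j := by
  induction j generalizing r with
  | zero =>
    rw [pow_zero, Submodule.mem_one] at hr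
    obtain ⟨c, rfl⟩ := hr
    rw [Algebra.algebraMap_eq_smul_one, map_smul, skEv_one]
    exact Submodule.smul_mem _ _ (Finsupp.single_mem_supported _ _ (by simp))
  | succ j ih =>
    rw [pow_succ'] at hr
    induction hr using Submodule.mul_induction_on' with
    | mem_mul_mem x hx y hy =>
      induction hx using Submodule.span_induction with
      | mem x hx =>
        obtain ⟨i, rfl⟩ := hx
        rw [skEv_gen_mul]
        exact skT_eq i j (ih hy)
      | zero => simp
      | add x y _ _ h1 h2 => rw [add_mul, map_add]; exact add_mem h1 h2
      | smul c x _ h => rw [smul_mul_assoc, map_smul]; exact Submodule.smul_mem _ _ h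
    | add x _ y _ hx hy => rw [map_add]; exact add_mem hx hy

theorem sV_inf (hp : SkAnti p) (j : ℕ) {r} 
    (hr : r ∈ Submodule.span k (Set.range (sgen p)) ^ j) (hr' : r ∈ skF (sM p) (j + 1)) : r = 0 := by
  apply (skEv_bij hp).1
  rw [map_zero]
  have h1 := skEv_V hp j hr
  have h2 := skEv_mem hp _ hr'
  rw [skEq, Finsupp.mem_supported] at h1
  rw [skGe, Finsupp.mem_supported] at h2
  rw [← Finsupp.support_eq_empty, ← Finset.coe_eq_empty, Set.eq_empty_iff_forall_notMem]
  intro a ha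
  have h3 := h1 ha
  have h4 := h2 ha
  simp only [Set.mem_ofPred_eq] at h3 h4
  omega

theorem smonL_mem (a : Fin n →₀ ℕ) (l : List (Fin n)) :
    smonL p l a ∈ skF (sM p) (l.map a).sum := by
  induction l with
  | nil => trivial
  | cons j l ih =>
    have h3 : smonL p (j :: l) a = sgen p j ^ a j * smonL p l a := by simp [smonL]
    rw [h3, List.map_cons, List.sum_cons]
    refine skF_mul sM_aug ?_ ih
    induction a j with
    | zero => trivial
    | succ b hb => rw [pow_succ]; exact Submodule.mul_mem_mul hb (sgen_mem j)

theorem smon_mem (a : Fin n →₀ ℕ) : smon p a ∈ skF (sM p) a.degree := by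
  have := smonL_mem (p := p) a (List.finRange n)
  rw [← List.ofFn_eq_map, List.sum_ofFn] at this
  rwa [Finsupp.degree_eq_sum]

theorem skEv_mem' (hp : SkAnti p) (j : ℕ) {r} (hr : skEv hp r ∈ skGe k n j) : r ∈ skF (sM p) j := by
  have : skGe k n j ≤ (skF (sM p) j).map (skEv hp) := by
    unfold skGe
    rw [Finsupp.supported_eq_span_single, Submodule.span_le]
    rintro _ ⟨a, ha, rfl⟩
    obtain ⟨c, hc, h⟩ := skEv_smon hp a
    refine ⟨c⁻¹ • smon p a, Submodule.smul_mem _ _ (skF_anti sM_aug ha (smon_mem a)), ?_⟩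
    rw [map_smul, h]
    simp [hc]
  obtain ⟨r', h1, h2⟩ := this hr
  rwa [← (skEv_bij hp).1 h2]

theorem sF_inf (hp : SkAnti p) {r : SkewPoly k n p} (h : ∀ j, r ∈ skF (sM p) j) : r = 0 := by
  apply (skEv_bij hp).1
  rw [map_zero]
  ext a
  by_contra h0
  have h2 := skEv_mem hp _ (h (a.degree + 1))
  rw [skGe, Finsupp.mem_supported] at h2
  have h4 := h2 (show a ∈ ((skEv hp r).support : Set _) by simpa using h0)
  simp only [Set.mem_ofPred_eq] at h4
  omega

/-- Homs preserve the filtration. -/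
theorem sk_hom_sub (hm : SkAug m) (g : SkewPoly k n p →ₐ[k] R) (hg : ∀ i, g (sgen p i) ∈ m)
    (r) : g r - algebraMap k R (sAug p r) ∈ m := by
  refine sk_ind (P := fun r => g r - algebraMap k R (sAug p r) ∈ m)
    (sgen_adjoin (p := p)) ?_ ?_ ?_ ?_ r
  · intro i; simpa [sAug_gen] using hg i
  · intro c; simp
  · intro a b ha hb
    have := add_mem ha hb
    simp only [map_add]
    convert this using 1
    abel
  · intro a b ha hb
    have := add_mem (hm.mul_right (g b) ha) (hm.mul_left (algebraMap k R (sAug p a)) hb)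
    simp only [map_mul]
    convert this using 1
    noncomm_ring

theorem sk_hom_F (hm : SkAug m) (g : SkewPoly k n p →ₐ[k] R) (hg : ∀ i, g (sgen p i) ∈ m)
    (j : ℕ) {r} (hr : r ∈ skF (sM p) j) : g r ∈ skF m j := by
  induction j generalizing r with
  | zero => trivial
  | succ j ih =>
    induction hr using Submodule.mul_induction_on' with
    | mem_mul_mem x hx y hy =>
      rw [map_mul]
      refine Submodule.mul_mem_mul (ih hx) ?_
      have := sk_hom_sub hm g hg y
      rwa [(mem_sM y).1 hy, map_zero, sub_zero] at this
    | add x _ y _ hx hy => rw [map_add]; exact add_mem hx hy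

theorem sk_equiv_m (hm : SkAug m) (g : SkewPoly k n p ≃ₐ[k] R) (hg : ∀ i, g (sgen p i) ∈ m)
    {r} (hr : g r ∈ m) : r ∈ sM p := by
  have h1 : g r - (g r - algebraMap k R (sAug p r)) ∈ m :=
    sub_mem hr (sk_hom_sub hm g.toAlgHom hg r)
  rw [sub_sub_cancel] at h1
  rw [mem_sM]
  by_contra h0
  apply hm.one_notMem
  have := hm.mul_left (algebraMap k R (sAug p r)⁻¹) h1
  rwa [← map_mul, inv_mul_cancel₀ h0, map_one] at this

theorem sk_equiv_F (hm : SkAug m) (g : SkewPoly k n p ≃ₐ[k] R) (hg : ∀ i, g (sgen p i) ∈ m)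
    (j : ℕ) {r} (hr : r ∈ skF m j) : g.symm r ∈ skF (sM p) j := by
  induction j generalizing r with
  | zero => trivial
  | succ j ih =>
    induction hr using Submodule.mul_induction_on' with
    | mem_mul_mem x hx y hy =>
      rw [map_mul]
      refine Submodule.mul_mem_mul (ih hx) ?_
      exact sk_equiv_m hm g hg (by simpa using hy)
    | add x _ y _ hx hy => rw [map_add]; exact add_mem hx hy

instance skGe_fin (j : ℕ) : Module.Finite k (SkM k n ⧸ skGe k n j) := by
  have hfin : Set.Finite {a : Fin n →₀ ℕ | a.degree ≤ j} := Finsupp.finite_of_degree_le j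
  have : Submodule.span k ((fun a : Fin n →₀ ℕ => (skGe k n j).mkQ (Finsupp.single a 1)) ''
      {a : Fin n →₀ ℕ | a.degree ≤ j}) = ⊤ := by
    rw [eq_top_iff, ← Submodule.range_mkQ, LinearMap.range_eq_map,
      ← Finsupp.supported_univ (M := k) (R := k), Finsupp.supported_eq_span_single,
      Submodule.map_span, Submodule.span_le]
    rintro _ ⟨_, ⟨a, _, rfl⟩, rfl⟩
    by_cases h : a.degree ≤ j
    · exact Submodule.subset_span ⟨a, h, rfl⟩
    · have : (skGe k n j).mkQ (Finsupp.single a 1) = 0 := by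
        rw [Submodule.mkQ_apply, Submodule.Quotient.mk_eq_zero]
        exact Finsupp.single_mem_supported _ _ (by simp only [Set.mem_ofPred_eq]; omega)
      simp only [SetLike.mem_coe]
      rw [this]
      exact zero_mem _
  exact ⟨⟨(hfin.image _).toFinset, by simpa using this⟩⟩

/-- A surjection between skew polynomial rings in the same number of variables preserving
augmentations is injective. -/
theorem sk_inj {q : Fin n → Fin n → k} (hp : SkAnti p) (hq : SkAnti q)
    (g : SkewPoly k n q →ₐ[k] SkewPoly k n p) (hg : ∀ i, g (sgen q i) ∈ sM p)
    (hs : Function.Surjective g) : Function.Injective g := by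
  let eq := LinearEquiv.ofBijective (skEv hq) (skEv_bij hq)
  let G : SkM k n →ₗ[k] SkM k n := skEv hp ∘ₗ g.toLinearMap ∘ₗ eq.symm.toLinearMap
  have hGs : Function.Surjective G :=
    (skEv_bij hp).2.comp (hs.comp eq.symm.surjective)
  have hG : ∀ j, skGe k n j ≤ (skGe k n j).comap G := by
    intro j u hu
    have h1 : eq.symm u ∈ skF (sM q) j := by
      apply skEv_mem' hq
      change eq (eq.symm u) ∈ _
      simpa using hu
    exact skEv_mem hp j (sk_hom_F sM_aug g hg j h1)
  rw [injective_iff_map_eq_zero]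
  intro r hr
  apply sF_inf hq
  intro j
  apply skEv_mem' hq
  have hQs : Function.Surjective (Submodule.mapQ _ _ G (hG j)) := by
    intro y
    obtain ⟨y, rfl⟩ := Submodule.mkQ_surjective _ y
    obtain ⟨x, rfl⟩ := hGs y
    exact ⟨Submodule.mkQ _ x, by simp⟩
  have hQi := LinearMap.injective_iff_surjective.2 hQs
  have : (skGe k n j).mkQ (skEv hq r) = 0 := by
    apply hQi
    rw [map_zero, Submodule.mkQ_apply, Submodule.mapQ_apply]
    have : G (skEv hq r) = 0 := by
      change skEv hp (g (eq.symm (eq r))) = 0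
      simp [hr]
    rw [this]; simp
  rwa [Submodule.mkQ_apply, Submodule.Quotient.mk_eq_zero] at this

end P2
end

noncomputable section

open Polynomial in
/-- A connected grading, encoded by its coaction. -/
structure SkGr (k : Type*) [Field k] (R : Type*) [Ring R] [Algebra k R] where
  θ : R →ₐ[k] R[X]
  c1 : ∀ r d, θ ((θ r).coeff d) = monomial d ((θ r).coeff d)
  c2 : ∀ r, (θ r).sum (fun _ a => a) = r
  c3 : ∀ r, ∃ c : k, (θ r).coeff 0 = algebraMap k R c

section P3
open Polynomial
variable {k : Type*} [Field k] {R : Type*} [Ring R] [Algebra k R] (gr : SkGr k R)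

namespace SkGr

def pi (d : ℕ) : R →ₗ[k] R where
  toFun r := (gr.θ r).coeff d
  map_add' := by intros; simp
  map_smul' := by intros; simp

theorem pi_mul (d : ℕ) (a b : R) :
    gr.pi d (a * b) = ∑ x ∈ Finset.HasAntidiagonal.antidiagonal d, gr.pi x.1 a * gr.pi x.2 b := by
  simp [pi, coeff_mul]

theorem pi_pi (d e : ℕ) (r : R) : gr.pi e (gr.pi d r) = if d = e then gr.pi d r else 0 := by
  change (gr.θ ((gr.θ r).coeff d)).coeff e = _
  rw [gr.c1, coeff_monomial]
  rfl

theorem θ_of_pi {d : ℕ} {r : R} (h : gr.pi d r = r) : gr.θ r = monomial d r := by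
  have := gr.c1 r d
  change gr.θ (gr.pi d r) = monomial d (gr.pi d r) at this
  rwa [h] at this

theorem pi_self (d : ℕ) (r : R) : gr.pi d (gr.pi d r) = gr.pi d r := by simp [pi_pi]

theorem pi_mul_left {d : ℕ} {r : R} (h : gr.pi d r = r) (e : ℕ) (a : R) :
    gr.pi (d + e) (r * a) = r * gr.pi e a := by
  change (gr.θ (r * a)).coeff _ = _
  rw [map_mul, gr.θ_of_pi h, add_comm, coeff_monomial_mul]
  rfl

theorem pi_mul_right {d : ℕ} {r : R} (h : gr.pi d r = r) (e : ℕ) (a : R) :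
    gr.pi (e + d) (a * r) = gr.pi e a * r := by
  change (gr.θ (a * r)).coeff _ = _
  rw [map_mul, gr.θ_of_pi h, coeff_mul_monomial]
  rfl

theorem sum_pi (r : R) : ∑ d ∈ (gr.θ r).support, gr.pi d r = r := gr.c2 r

def m : Submodule k R := LinearMap.ker (gr.pi 0)

theorem mem_m (r : R) : r ∈ gr.m ↔ gr.pi 0 r = 0 := by simp [m]

theorem pi_zero_mul (a b : R) : gr.pi 0 (a * b) = gr.pi 0 a * gr.pi 0 b := by
  simp [pi_mul]

theorem pi_zero_alg (c : k) : gr.pi 0 (algebraMap k R c) = algebraMap k R c := by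
  change (gr.θ _).coeff 0 = _
  rw [AlgHom.commutes]
  rw [Polynomial.algebraMap_apply, coeff_C_zero]

theorem aug [Nontrivial R] : SkAug gr.m where
  ex r := by
    obtain ⟨c, hc⟩ := gr.c3 r
    refine ⟨c, ?_⟩
    rw [mem_m, map_sub, pi_zero_alg]
    exact sub_eq_zero.2 hc
  mul_left r a ha := by rw [mem_m] at *; rw [pi_zero_mul, ha, mul_zero]
  mul_right r a ha := by rw [mem_m] at *; rw [pi_zero_mul, ha, zero_mul]
  one_notMem := by
    rw [mem_m]
    have := gr.pi_zero_alg 1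
    rw [map_one] at this
    rw [this]
    exact one_ne_zero

theorem pi_m (d : ℕ) {r : R} (hr : r ∈ gr.m) : gr.pi d r ∈ gr.m := by
  rw [mem_m] at *
  rw [pi_pi]
  split_ifs with h
  · rw [h, hr]
  · rfl

theorem pi_F (j d : ℕ) {r : R} (hr : r ∈ skF gr.m j) : gr.pi d r ∈ skF gr.m j := by
  induction j generalizing r d with
  | zero => trivial
  | succ j ih =>
    induction hr using Submodule.mul_induction_on' with
    | mem_mul_mem x hx y hy =>
      rw [pi_mul]
      exact sum_mem fun z _ => Submodule.mul_mem_mul (ih _ hx) (gr.pi_m _ hy)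
    | add x _ y _ hx hy => rw [map_add]; exact add_mem hx hy

theorem pi_F_lt (j d : ℕ) (h : d < j) {r : R} (hr : r ∈ skF gr.m j) : gr.pi d r = 0 := by
  induction j generalizing r d with
  | zero => omega
  | succ j ih =>
    induction hr using Submodule.mul_induction_on' with
    | mem_mul_mem x hx y hy =>
      rw [pi_mul]
      apply Finset.sum_eq_zero
      intro z hz
      rw [Finset.HasAntidiagonal.mem_antidiagonal] at hz
      by_cases h2 : z.2 = 0
      · rw [h2, (gr.mem_m y).1 hy, mul_zero]
      · rw [ih z.1 (by omega) hx, zero_mul]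
    | add x _ y _ hx hy => rw [map_add, hx, hy, add_zero]

end SkGr

/-! ### exponentials of derivations -/

theorem sk_leib {E : Module.End k R} (hE : ∀ a b, E (a * b) = E a * b + a * E b) (N : ℕ) (a b : R) :
    (E ^ N) (a * b) = ∑ x ∈ Finset.HasAntidiagonal.antidiagonal N, N.choose x.1 • ((E ^ x.1) a * (E ^ x.2) b) := by
  induction N with
  | zero => simp
  | succ N ih =>
    rw [Finset.sum_antidiagonal_choose_succ_nsmul (fun i j => (E ^ i) a * (E ^ j) b),
      pow_succ', Module.End.mul_apply, ih, map_sum, ← Finset.sum_add_distrib]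
    apply Finset.sum_congr rfl
    intro x hx
    rw [map_nsmul, hE, pow_succ', pow_succ', Module.End.mul_apply, Module.End.mul_apply, smul_add,
      add_comm, Nat.choose_symm_of_eq_add (Finset.HasAntidiagonal.mem_antidiagonal.1 hx).symm]

def skExp (N : ℕ) (E : Module.End k R) : Module.End k R :=
  ∑ j ∈ Finset.range N, ((j.factorial : k)⁻¹) • E ^ j

theorem skExp_apply (N : ℕ) (E : Module.End k R) (r : R) :
    skExp N E r = ∑ j ∈ Finset.range N, ((j.factorial : k)⁻¹) • (E ^ j) r := by
  simp [skExp]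

theorem skE_pow {m : Submodule k R} {E : Module.End k R}
    (hEF : ∀ j r, r ∈ skF m j → E r ∈ skF m (j + 1)) (l j : ℕ) {r : R} (hr : r ∈ skF m j) :
    (E ^ l) r ∈ skF m (j + l) := by
  induction l with
  | zero => simpa using hr
  | succ l ih => rw [pow_succ', Module.End.mul_apply]; exact hEF _ _ ih

theorem skExp_mul [CharZero k] {m : Submodule k R} (hm : SkAug m) {E : Module.End k R}
    (hE : ∀ a b, E (a * b) = E a * b + a * E b)
    (hEF : ∀ j r, r ∈ skF m j → E r ∈ skF m (j + 1)) (N : ℕ) (a b : R) :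
    skExp N E (a * b) - skExp N E a * skExp N E b ∈ skF m N := by
  set g : ℕ → ℕ → R := fun i j =>
    ((i.factorial : k)⁻¹ • (E ^ i) a) * ((j.factorial : k)⁻¹ • (E ^ j) b) with hg
  have h1 : skExp N E (a * b) =
      ∑ l ∈ Finset.range N, ∑ x ∈ Finset.HasAntidiagonal.antidiagonal l, g x.1 x.2 := by
    rw [skExp_apply]
    apply Finset.sum_congr rfl
    intro l _
    rw [sk_leib hE, Finset.smul_sum]
    apply Finset.sum_congr rfl
    intro x hx
    rw [hg]
    simp only [smul_mul_assoc, mul_smul_comm, smul_smul]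
    rw [← Nat.cast_smul_eq_nsmul k, smul_smul]
    congr 1
    have e := Finset.HasAntidiagonal.mem_antidiagonal.1 hx
    rw [← e, ← Nat.add_choose_mul_factorial_mul_factorial x.1 x.2]
    have := Nat.cast_ne_zero (R := k).2 (Nat.factorial_ne_zero x.1)
    have := Nat.cast_ne_zero (R := k).2 (Nat.factorial_ne_zero x.2)
    have := Nat.cast_ne_zero (R := k).2 (Nat.choose_pos (Nat.le_add_right x.1 x.2)).ne'
    have hc : (x.1 + x.2).choose x.2 = (x.1 + x.2).choose x.1 := Nat.choose_symm_add.symm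
    simp only [hc]
    push_cast
    field_simp
  have h2 : skExp N E a * skExp N E b =
      ∑ x ∈ Finset.range N ×ˢ Finset.range N, g x.1 x.2 := by
    rw [skExp_apply, skExp_apply, Finset.sum_mul_sum, Finset.sum_product]
  have h3 : ∑ l ∈ Finset.range N, ∑ x ∈ Finset.HasAntidiagonal.antidiagonal l, g x.1 x.2 =
      ∑ x ∈ (Finset.range N ×ˢ Finset.range N).filter (fun x => x.1 + x.2 < N), g x.1 x.2 := by
    rw [Finset.sum_sigma']
    refine Finset.sum_bij' (fun x _ => x.2) (fun x _ => ⟨x.1 + x.2, x⟩) ?_ ?_ ?_ ?_ ?_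
    · rintro ⟨l, i, j⟩ h
      simp only [Finset.mem_sigma, Finset.mem_range, Finset.HasAntidiagonal.mem_antidiagonal, Finset.mem_filter,
        Finset.mem_product] at *
      omega
    · rintro ⟨i, j⟩ h
      simp only [Finset.mem_filter, Finset.mem_product, Finset.mem_range] at h
      exact Finset.mem_sigma.2 ⟨Finset.mem_range.2 h.2, Finset.HasAntidiagonal.mem_antidiagonal.2 rfl⟩
    · rintro ⟨l, i, j⟩ h
      simp only [Finset.mem_sigma, Finset.mem_range, Finset.HasAntidiagonal.mem_antidiagonal] at h
      obtain ⟨_, rfl⟩ := h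
      rfl
    · rintro ⟨i, j⟩ h; rfl
    · rintro ⟨l, i, j⟩ h; rfl
  rw [h1, h2, h3, ← Finset.sum_filter_add_sum_filter_not (Finset.range N ×ˢ Finset.range N)
    (fun x => x.1 + x.2 < N), sub_add_cancel_left]
  refine neg_mem (sum_mem fun x hx => ?_)
  rw [Finset.mem_filter, not_lt] at hx
  refine skF_mul' hm hx.2 (Submodule.smul_mem _ _ ?_) (Submodule.smul_mem _ _ ?_)
  · simpa using skE_pow hEF x.1 0 (r := a) trivial
  · simpa using skE_pow hEF x.2 0 (r := b) trivial

theorem skExp_sub [CharZero k] {m : Submodule k R} (hm : SkAug m) {E : Module.End k R}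
    (hEF : ∀ j r, r ∈ skF m j → E r ∈ skF m (j + 1)) (N i : ℕ) (hN : 2 ≤ N) {r : R}
    (hr : E r ∈ skF m i) : skExp N E r - (r + E r) ∈ skF m (i + 1) := by
  obtain ⟨N, rfl⟩ := Nat.exists_eq_add_of_le hN
  rw [skExp_apply, Finset.sum_range_add]
  simp only [Finset.sum_range_succ, Finset.sum_range_zero, Nat.factorial, zero_add, pow_zero, pow_one,
    mul_one, Nat.cast_one, inv_one, one_smul, Module.End.one_apply]
  rw [add_sub_cancel_left]
  refine sum_mem fun x _ => Submodule.smul_mem _ _ ?_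
  rw [show 2 + x = (1 + x) + 1 by omega, pow_succ, Module.End.mul_apply]
  exact skF_anti hm (by omega) (skE_pow hEF (1 + x) i hr)

end P3
end

noncomputable section
section P4
open Polynomial
variable {k : Type*} [Field k] {R : Type*} [Ring R] [Algebra k R]
variable {n : ℕ} {p : Fin n → Fin n → k}

theorem sk_X_adjoin (Φ : SkewPoly k n p ≃ₐ[k] R) :
    Algebra.adjoin k (Set.range (fun a => Φ (sgen p a))) = ⊤ := by
  have h2 := congrArg (Subalgebra.map (Φ : SkewPoly k n p →ₐ[k] R)) (sgen_adjoin (p := p))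
  rw [AlgHom.map_adjoin, ← Set.range_comp, Algebra.map_top,
    (AlgHom.range_eq_top _).2 Φ.surjective] at h2
  exact h2

theorem sk_X_sys (hp : SkAnti p) (Φ : SkewPoly k n p ≃ₐ[k] R) :
    SkSys p (fun a => Φ (sgen p a)) := by
  intro i j
  simp only [← map_mul, ← map_smul]
  rw [sgen_sys hp i j]

theorem sk_V_symm (Φ : SkewPoly k n p ≃ₐ[k] R) (j : ℕ) {r : R}
    (hr : r ∈ Submodule.span k (Set.range (fun a => Φ (sgen p a))) ^ j) :
    Φ.symm r ∈ Submodule.span k (Set.range (sgen p)) ^ j := by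
  have h : Submodule.span k (Set.range (fun a => Φ (sgen p a))) =
      (Submodule.span k (Set.range (sgen p))).map (Φ : SkewPoly k n p →ₐ[k] R).toLinearMap := by
    rw [Submodule.map_span, ← Set.range_comp]
    rfl
  rw [h, ← Submodule.map_pow] at hr
  obtain ⟨s, hs, rfl⟩ := hr
  simpa using hs

theorem sk_hV (hp : SkAnti p) {m : Submodule k R} (hm : SkAug m) (Φ : SkewPoly k n p ≃ₐ[k] R)
    (hX : ∀ a, Φ (sgen p a) ∈ m) (j : ℕ) {r : R}
    (hr : r ∈ Submodule.span k (Set.range (fun a => Φ (sgen p a))) ^ j)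
    (hr' : r ∈ skF m (j + 1)) : r = 0 := by
  have := sV_inf hp j (sk_V_symm Φ j hr) (sk_equiv_F hm Φ hX (j + 1) hr')
  simpa using this

theorem skDer (Φ : SkewPoly k n p ≃ₐ[k] R) (hp : SkAnti p) (h : Fin n → R)
    (hh : ∀ a b, Φ (sgen p b) * h a + h b * Φ (sgen p a) =
      p a b • (Φ (sgen p a) * h b + h a * Φ (sgen p b))) :
    ∃ E : Module.End k R, (∀ a b, E (a * b) = E a * b + a * E b) ∧
      ∀ a, E (Φ (sgen p a)) = h a := by
  let Y : Fin n → TrivSqZeroExt R R := fun a => (Φ (sgen p a), h a)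
  have hf : ∀ a, (Y a).fst = Φ (sgen p a) := fun a => rfl
  have hs : ∀ a, (Y a).snd = h a := fun a => rfl
  have hY : SkSys p Y := by
    intro i j
    ext
    · rw [TrivSqZeroExt.fst_mul, TrivSqZeroExt.fst_smul, TrivSqZeroExt.fst_mul, hf, hf]
      exact sk_X_sys hp Φ i j
    · rw [TrivSqZeroExt.snd_mul, TrivSqZeroExt.snd_smul, TrivSqZeroExt.snd_mul, hf, hf, hs, hs]
      simpa using hh i j
  let g := slift Y hY
  have hg : ∀ r, (g r).fst = Φ r := by
    intro r
    have : (TrivSqZeroExt.fstHom k R R).comp g = (Φ : SkewPoly k n p →ₐ[k] R) := by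
      apply shom_ext
      intro i
      simp [g, hf]
    exact DFunLike.congr_fun this r
  refine ⟨(TrivSqZeroExt.sndHom R R).restrictScalars k ∘ₗ g.toLinearMap ∘ₗ
    (Φ.symm : R →ₐ[k] SkewPoly k n p).toLinearMap, ?_, ?_⟩
  · intro a b
    change (g (Φ.symm (a * b))).snd = (g (Φ.symm a)).snd * b + a * (g (Φ.symm b)).snd
    rw [map_mul, map_mul, TrivSqZeroExt.snd_mul, hg, hg]
    simp [add_comm]
  · intro a
    change (g (Φ.symm (Φ (sgen p a)))).snd = h a
    simp [g, hs]

variable {m : Submodule k R}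

section approx
variable {X : Fin n → R} {N : ℕ} {f : Module.End k R}

theorem skf_sub (hm : SkAug m) (hX' : Algebra.adjoin k (Set.range X) = ⊤) (hN : 2 ≤ N)
    (h1 : f 1 = 1) (hf : ∀ a b, f (a * b) - f a * f b ∈ skF m N)
    (hfX : ∀ a, f (X a) - X a ∈ skF m 2) (r : R) : f r - r ∈ skF m 2 := by
  refine sk_ind (P := fun r => f r - r ∈ skF m 2) hX' hfX ?_ ?_ ?_ r
  · intro c
    rw [Algebra.algebraMap_eq_smul_one, map_smul, h1, sub_self]
    exact zero_mem _
  · intro a b ha hb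
    rw [map_add, add_sub_add_comm]
    exact add_mem ha hb
  · intro a b ha hb
    have : f (a * b) - a * b = (f (a * b) - f a * f b) + ((f a - a) * f b + a * (f b - b)) := by
      noncomm_ring
    rw [this]
    exact add_mem (skF_anti hm hN (hf a b))
      (add_mem (skF_mul_right hm _ _ ha) (skF_mul_left hm _ _ hb))

theorem skf_subF (hm : SkAug m) (hX' : Algebra.adjoin k (Set.range X) = ⊤) (hN : 2 ≤ N)
    (h1 : f 1 = 1) (hf : ∀ a b, f (a * b) - f a * f b ∈ skF m N)
    (hfX : ∀ a, f (X a) - X a ∈ skF m 2) (j : ℕ) (hj : j + 1 ≤ N) {r : R} (hr : r ∈ skF m j) :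
    f r - r ∈ skF m (j + 1) := by
  induction j generalizing r with
  | zero => exact skF_succ_le hm _ (skf_sub hm hX' hN h1 hf hfX r)
  | succ j ih =>
    induction hr using Submodule.mul_induction_on' with
    | mem_mul_mem x hx y hy =>
      have : f (x * y) - x * y = (f (x * y) - f x * f y) + ((f x - x) * f y + x * (f y - y)) := by
        noncomm_ring
      rw [this]
      have h2 := skf_sub hm hX' hN h1 hf hfX y
      have h3 : f y ∈ skF m 1 := by
        have := add_mem (skF_anti hm (by norm_num : 1 ≤ 2) h2) ((skF_one hm).symm ▸ hy)
        simpa using this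
      exact add_mem (skF_anti hm hj (hf x y)) (add_mem
        (skF_mul' hm (by omega) (ih (by omega) hx) h3) (skF_mul' hm (by omega) hx h2))
    | add x _ y _ hx hy => rw [map_add, add_sub_add_comm]; exact add_mem hx hy

theorem skf_F (hm : SkAug m) (hX' : Algebra.adjoin k (Set.range X) = ⊤) (hN : 2 ≤ N)
    (h1 : f 1 = 1) (hf : ∀ a b, f (a * b) - f a * f b ∈ skF m N)
    (hfX : ∀ a, f (X a) - X a ∈ skF m 2) {r : R} (hr : r ∈ skF m N) :
    f r ∈ skF m N := by
  obtain ⟨N, rfl⟩ : ∃ M, N = M + 1 := ⟨N - 1, by omega⟩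
  have := skf_subF hm hX' hN h1 hf hfX N le_rfl (skF_succ_le hm _ hr)
  simpa using add_mem this hr

end approx

variable (gr : SkGr k R)

theorem skz_rel {gr : SkGr k R} (hm : SkAug gr.m) {d : Fin n → ℕ} {y : Fin n → R} {N i l : ℕ} (hl : l ≤ N)
    (hl' : l ≤ 2 * i)
    (hy : ∀ a b, y b * y a - p a b • (y a * y b) ∈ skF gr.m N)
    (hi : ∀ a, y a - gr.pi (d a) (y a) ∈ skF gr.m i) (a b : Fin n) :
    gr.pi (d b) (y b) * gr.pi (d a) (y a) - p a b • (gr.pi (d a) (y a) * gr.pi (d b) (y b))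
      ∈ skF gr.m l := by
  set z := fun a => gr.pi (d a) (y a) with hz
  set H := fun a => y a - z a with hH
  have hHi : ∀ a, H a ∈ skF gr.m i := hi
  have hz0 : ∀ a, gr.pi (d a) (z a) = z a := fun a => gr.pi_self _ _
  have hH0 : ∀ a, gr.pi (d a) (H a) = 0 := fun a => by
    simp only [hH, map_sub, hz0]; simp only [hz, sub_self]
  have hyz : ∀ a, y a = z a + H a := fun a => by simp [hH]
  have e1 : gr.pi (d b + d a) (y b * y a) = z b * z a + gr.pi (d b + d a) (H b * H a) := by
    rw [hyz a, hyz b]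
    rw [add_mul, mul_add, mul_add, map_add, map_add, map_add, gr.pi_mul_left (hz0 b),
      gr.pi_mul_left (hz0 b), gr.pi_mul_right (hz0 a), hH0, hH0, hz0]
    simp
  have e2 : gr.pi (d b + d a) (y a * y b) = z a * z b + gr.pi (d b + d a) (H a * H b) := by
    rw [hyz a, hyz b, add_comm (d b)]
    rw [add_mul, mul_add, mul_add, map_add, map_add, map_add, gr.pi_mul_left (hz0 a),
      gr.pi_mul_left (hz0 a), gr.pi_mul_right (hz0 b), hH0, hH0, hz0]
    simp
  have e3 := gr.pi_F _ (d b + d a) (skF_anti hm hl (hy a b))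
  rw [map_sub, map_smul, e1, e2] at e3
  have e4 := gr.pi_F _ (d b + d a) (skF_mul' hm (l := l) (by omega) (hHi b) (hHi a))
  have e5 := gr.pi_F _ (d b + d a) (skF_mul' hm (l := l) (by omega) (hHi a) (hHi b))
  have e6 := add_mem (sub_mem e3 e4) (Submodule.smul_mem _ (p a b) e5)
  convert e6 using 1
  rw [smul_add]
  abel

theorem skT_step [CharZero k] {gr : SkGr k R} (hm : SkAug gr.m) (hp : SkAnti p) (Φ : SkewPoly k n p ≃ₐ[k] R)
    (hX : ∀ a, Φ (sgen p a) ∈ gr.m) {d : Fin n → ℕ} {N i : ℕ} (hi : 2 ≤ i) (hiN : i + 2 ≤ N)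
    (hex : ∃ f : Module.End k R, f 1 = 1 ∧ (∀ a b, f (a * b) - f a * f b ∈ skF gr.m N) ∧
      (∀ a, f (Φ (sgen p a)) - Φ (sgen p a) ∈ skF gr.m 2) ∧
      (∀ a, f (Φ (sgen p a)) - gr.pi (d a) (f (Φ (sgen p a))) ∈ skF gr.m i)) :
    ∃ f : Module.End k R, f 1 = 1 ∧ (∀ a b, f (a * b) - f a * f b ∈ skF gr.m N) ∧
      (∀ a, f (Φ (sgen p a)) - Φ (sgen p a) ∈ skF gr.m 2) ∧
      (∀ a, f (Φ (sgen p a)) - gr.pi (d a) (f (Φ (sgen p a))) ∈ skF gr.m (i + 1)) := by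
  obtain ⟨f, h1, hf, hfX, hfi⟩ := hex
  have hX' := sk_X_adjoin Φ
  have hsys := sk_X_sys hp Φ
  set X := fun a => Φ (sgen p a) with hXdef
  change ∀ a, X a ∈ gr.m at hX
  change ∀ a, f (X a) - X a ∈ skF gr.m 2 at hfX
  change ∀ a, f (X a) - gr.pi (d a) (f (X a)) ∈ skF gr.m i at hfi
  have hy : ∀ a b, f (X b) * f (X a) - p a b • (f (X a) * f (X b)) ∈ skF gr.m N := by
    intro a b
    have := sub_mem (Submodule.smul_mem _ (p a b) (hf (X a) (X b))) (hf (X b) (X a))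
    rw [hsys a b, map_smul] at this
    convert this using 1
    rw [smul_sub]; abel
  have hzr := skz_rel hm (l := i + 2) hiN (by omega) hy hfi
  set z := fun a => gr.pi (d a) (f (X a)) with hz
  set H := fun a => f (X a) - z a with hH
  have hHi : ∀ a, H a ∈ skF gr.m i := hfi
  have hzX : ∀ a, X a - z a ∈ skF gr.m 2 := by
    intro a
    have := sub_mem (skF_anti hm hi (hHi a)) (hfX a)
    convert this using 1
    simp only [hH]; abel
  have hX1 : ∀ a, X a ∈ skF gr.m 1 := fun a => (skF_one hm).symm ▸ hX a
  have hz1 : ∀ a, z a ∈ skF gr.m 1 := fun a => by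
    have := sub_mem (hX1 a) (skF_anti hm (by norm_num : 1 ≤ 2) (hzX a))
    rwa [sub_sub_cancel] at this
  have hch : ∀ a, ∃ h ∈ Submodule.span k (Set.range X) ^ i, H a - h ∈ skF gr.m (i + 1) := by
    intro a
    obtain ⟨v, hv, w, hw, e⟩ := Submodule.mem_sup.1 (skF_le hm hX hX' i (by omega) (hHi a))
    exact ⟨v, hv, by rw [← e, add_sub_cancel_left]; exact hw⟩
  choose h hhV hhH using hch
  have hhi : ∀ a, h a ∈ skF gr.m i := fun a => skV_pow_le hm hX i (hhV a)
  have hXV : ∀ a, X a ∈ Submodule.span k (Set.range X) := fun a => Submodule.subset_span ⟨a, rfl⟩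
  have hrel : ∀ a b, X b * h a + h b * X a = p a b • (X a * h b + h a * X b) := by
    intro a b
    rw [← sub_eq_zero]
    have t1 : ∀ a b, X b * h a ∈ Submodule.span k (Set.range X) ^ (i + 1) := fun a b => by
      rw [pow_succ']; exact Submodule.mul_mem_mul (hXV b) (hhV a)
    have t2 : ∀ a b, h b * X a ∈ Submodule.span k (Set.range X) ^ (i + 1) := fun a b => by
      rw [pow_succ]; exact Submodule.mul_mem_mul (hhV b) (hXV a)
    refine sk_hV hp hm Φ hX (i + 1) (sub_mem (add_mem (t1 a b) (t2 a b))
      (Submodule.smul_mem _ _ (add_mem (t1 b a) (t2 b a)))) ?_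
    have s1 : ∀ a b, X b * h a - z b * H a ∈ skF gr.m (i + 2) := fun a b => by
      have : X b * h a - z b * H a = (X b - z b) * h a - z b * (H a - h a) := by noncomm_ring
      rw [this]
      exact sub_mem (skF_mul' hm (by omega) (hzX b) (hhi a))
        (skF_mul' hm (by omega) (hz1 b) (hhH a))
    have s2 : ∀ a b, h b * X a - H b * z a ∈ skF gr.m (i + 2) := fun a b => by
      have : h b * X a - H b * z a = h b * (X a - z a) - (H b - h b) * z a := by noncomm_ring
      rw [this]
      exact sub_mem (skF_mul' hm (by omega) (hhi b) (hzX a))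
        (skF_mul' hm (by omega) (hhH b) (hz1 a))
    have s3 : ∀ a b, H b * H a ∈ skF gr.m (i + 2) := fun a b =>
      skF_mul' hm (by omega) (hHi b) (hHi a)
    have hL : z b * H a + H b * z a - p a b • (z a * H b + H a * z b) ∈ skF gr.m (i + 2) := by
      have := sub_mem (sub_mem (skF_anti hm hiN (hy a b)) (hzr a b))
        (sub_mem (s3 a b) (Submodule.smul_mem _ (p a b) (s3 b a)))
      convert this using 1
      have hyz : ∀ a, f (X a) = z a + H a := fun a => by simp [hH]
      rw [hyz a, hyz b]
      have hz' : ∀ a, gr.pi (d a) (z a + H a) = z a := fun a => by rw [← hyz a]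
      rw [hz', hz']
      simp only [add_mul, mul_add, smul_add]
      abel
    have := add_mem (sub_mem (add_mem (s1 a b) (s2 a b))
      (Submodule.smul_mem _ (p a b) (add_mem (s1 b a) (s2 b a)))) hL
    convert this using 1
    simp only [smul_add, smul_sub]
    abel
  obtain ⟨E, hE, hEX⟩ := skDer Φ hp (fun a => - h a) (by
    intro a b
    have := congrArg Neg.neg (hrel a b)
    simp only [hXdef] at this
    simp only [mul_neg, neg_mul, ← neg_add]
    rw [this, ← smul_neg])
  change ∀ a, E (X a) = - h a at hEX
  have hE1 : E 1 = 0 := by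
    have := hE 1 1
    simpa using this
  have hEi : ∀ r, E r ∈ skF gr.m i := by
    intro r
    refine sk_ind (P := fun r => E r ∈ skF gr.m i) hX' ?_ ?_ ?_ ?_ r
    · intro a
      change E (X a) ∈ _
      rw [hEX]; exact neg_mem (hhi a)
    · intro c
      rw [Algebra.algebraMap_eq_smul_one, map_smul, hE1, smul_zero]; exact zero_mem _
    · intro a b ha hb; rw [map_add]; exact add_mem ha hb
    · intro a b ha hb
      rw [hE]; exact add_mem (skF_mul_right hm _ _ ha) (skF_mul_left hm _ _ hb)
  have hEF : ∀ j r, r ∈ skF gr.m j → E r ∈ skF gr.m (j + 1) := by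
    intro j
    induction j with
    | zero => intro r _; exact skF_anti hm (by omega) (hEi r)
    | succ j ih =>
      intro r hr
      induction hr using Submodule.mul_induction_on' with
      | mem_mul_mem x hx y hy =>
        rw [hE]
        exact add_mem (Submodule.mul_mem_mul (ih x hx) hy) (skF_mul' hm (by omega) hx (hEi y))
      | add x _ y _ hx hy => rw [map_add]; exact add_mem hx hy
  have he1 : skExp N E 1 = 1 := by
    rw [skExp_apply, Finset.sum_eq_single 0]
    · simp
    · intro j _ hj
      obtain ⟨j, rfl⟩ := Nat.exists_eq_succ_of_ne_zero hj
      rw [pow_succ, Module.End.mul_apply, hE1, map_zero, smul_zero]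
    · intro h; exact absurd (Finset.mem_range.2 (by omega)) h
  have hu : ∀ a, skExp N E (X a) - (X a - h a) ∈ skF gr.m (i + 1) := by
    intro a
    have := skExp_sub hm hEF N i (by omega) (hEi (X a))
    rwa [hEX, ← sub_eq_add_neg] at this
  have hfz : ∀ a, f (skExp N E (X a)) - z a ∈ skF gr.m (i + 1) := by
    intro a
    have hsub : ∀ {r}, r ∈ skF gr.m (i + 1) → f r ∈ skF gr.m (i + 1) := fun {r} hr => by
      have := add_mem (skF_succ_le hm _ (skf_subF hm hX' (by omega) h1 hf hfX (i + 1) (by omega) hr)) hr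
      simpa using this
    have e1 := hsub (hu a)
    rw [map_sub, map_sub] at e1
    have e2 := skf_subF hm hX' (by omega) h1 hf hfX i (by omega) (hhi a)
    have e3 := hhH a
    have := add_mem (sub_mem e1 e2) e3
    convert this using 1
    simp only [hH]
    abel
  refine ⟨f ∘ₗ skExp N E, by simp [he1, h1], ?_, ?_, ?_⟩
  · intro a b
    simp only [LinearMap.comp_apply]
    have e1 := skf_F hm hX' (by omega) h1 hf hfX (skExp_mul hm hE hEF N a b)
    have e2 := add_mem e1 (hf (skExp N E a) (skExp N E b))
    rw [map_sub] at e2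
    convert e2 using 1
    abel
  · intro a
    change f (skExp N E (X a)) - X a ∈ _
    have := sub_mem (skF_anti hm (by omega : 2 ≤ i + 1) (hfz a)) (hzX a)
    convert this using 1
    abel
  · intro a
    change f (skExp N E (X a)) - gr.pi (d a) (f (skExp N E (X a))) ∈ _
    have e := sub_mem (hfz a) (gr.pi_F _ (d a) (hfz a))
    have hz0 : gr.pi (d a) (z a) = z a := gr.pi_self _ _
    rw [map_sub, hz0] at e
    convert e using 1
    abel

/-- homogenisation theorem -/
theorem skHomog [CharZero k] {gr : SkGr k R} (hm : SkAug gr.m) (hp : SkAnti p) (Φ : SkewPoly k n p ≃ₐ[k] R)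
    (hX : ∀ a, Φ (sgen p a) ∈ gr.m) {d : Fin n → ℕ}
    (hd : ∀ a, Φ (sgen p a) - gr.pi (d a) (Φ (sgen p a)) ∈ skF gr.m 2) :
    ∃ z : Fin n → R, (∀ a, gr.pi (d a) (z a) = z a) ∧
      (∀ a, z a - Φ (sgen p a) ∈ skF gr.m 2) ∧ SkSys p z := by
  have key : ∀ N i : ℕ, 2 ≤ i → i + 1 ≤ N →
      ∃ f : Module.End k R, f 1 = 1 ∧ (∀ a b, f (a * b) - f a * f b ∈ skF gr.m N) ∧
      (∀ a, f (Φ (sgen p a)) - Φ (sgen p a) ∈ skF gr.m 2) ∧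
      (∀ a, f (Φ (sgen p a)) - gr.pi (d a) (f (Φ (sgen p a))) ∈ skF gr.m i) := by
    intro N i hi
    induction i, hi using Nat.le_induction with
    | base =>
      intro hN
      exact ⟨LinearMap.id, rfl, by simp, by simp, hd⟩
    | succ i hi ih =>
      intro hN
      exact skT_step hm hp Φ hX hi (by omega) (ih (by omega))
  obtain ⟨f, h1, hf, hfX, hfi⟩ := key (4 + 2 * ∑ a, d a) (3 + 2 * ∑ a, d a) (by omega) (by omega)
  have hsys := sk_X_sys hp Φ
  have hy : ∀ a b, f (Φ (sgen p b)) * f (Φ (sgen p a)) -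
      p a b • (f (Φ (sgen p a)) * f (Φ (sgen p b))) ∈ skF gr.m (4 + 2 * ∑ a, d a) := by
    intro a b
    have := sub_mem (Submodule.smul_mem _ (p a b) (hf (Φ (sgen p a)) (Φ (sgen p b))))
      (hf (Φ (sgen p b)) (Φ (sgen p a)))
    have e : Φ (sgen p b) * Φ (sgen p a) = p a b • (Φ (sgen p a) * Φ (sgen p b)) := hsys a b
    rw [e, map_smul] at this
    convert this using 1
    rw [smul_sub]; abel
  have hzr := skz_rel hm (l := 4 + 2 * ∑ a, d a) le_rfl (by omega) hy hfi
  have hz0 : ∀ a, gr.pi (d a) (gr.pi (d a) (f (Φ (sgen p a)))) = gr.pi (d a) (f (Φ (sgen p a))) :=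
    fun a => gr.pi_self _ _
  refine ⟨fun a => gr.pi (d a) (f (Φ (sgen p a))), hz0, ?_, ?_⟩
  · intro a
    have := sub_mem (hfX a) (skF_anti hm (by omega) (hfi a))
    convert this using 1
    abel
  · intro a b
    have hle : ∀ a, d a ≤ ∑ a, d a := fun a =>
      Finset.single_le_sum (fun _ _ => Nat.zero_le _) (Finset.mem_univ a)
    have h2 := gr.pi_F_lt _ (d b + d a) (by have := hle a; have := hle b; omega) (hzr a b)
    rw [map_sub, map_smul, gr.pi_mul_left (hz0 b), add_comm (d b), gr.pi_mul_left (hz0 a), hz0,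
      hz0] at h2
    exact sub_eq_zero.1 h2

end P4
end

noncomputable section
section P5
open Polynomial
variable {k : Type*} [Field k] {R : Type*} [Ring R] [Algebra k R]
variable {n : ℕ} {p : Fin n → Fin n → k}

def skEps (R : Type*) [Ring R] : R[X] →+* R :=
  eval₂RingHom' (RingHom.id R) 1 (fun a => Commute.one_right a)

theorem skEps_monomial (d : ℕ) (r : R) : skEps R (monomial d r) = r := by
  simp [skEps]

theorem skEps_sum (f : R[X]) : skEps R f = f.sum (fun _ a => a) := by
  change eval₂ _ _ f = _
  simp [eval₂_eq_sum]

namespace SkGr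
variable (gr : SkGr k R)

def D : R →ₗ[k] R where
  toFun r := skEps R (derivative (gr.θ r))
  map_add' := by intros; simp
  map_smul' c r := by
    rw [map_smul, derivative_smul, RingHom.id_apply, Algebra.smul_def, map_mul,
      Polynomial.algebraMap_apply, Algebra.smul_def]
    congr 1
    exact skEps_monomial 0 _

theorem D_mul (a b : R) : gr.D (a * b) = gr.D a * b + a * gr.D b := by
  change skEps R (derivative (gr.θ (a * b))) = skEps R _ * b + a * skEps R _
  rw [map_mul, derivative_mul, map_add, map_mul, map_mul, skEps_sum (gr.θ a), skEps_sum (gr.θ b),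
    gr.c2, gr.c2]

theorem D_pi (d : ℕ) (r : R) : gr.D (gr.pi d r) = (d : k) • gr.pi d r := by
  change skEps R (derivative (gr.θ _)) = _
  rw [gr.θ_of_pi (gr.pi_self d r), derivative_monomial, skEps_monomial, Algebra.smul_def, map_natCast]
  exact (Nat.cast_commute d _).symm

theorem D_eq (r : R) : gr.D r = ∑ d ∈ (gr.θ r).support, (d : k) • gr.pi d r := by
  conv_lhs => rw [← gr.sum_pi r]
  rw [map_sum]
  exact Finset.sum_congr rfl fun d _ => gr.D_pi d r

theorem D_F (j : ℕ) {r : R} (hr : r ∈ skF gr.m j) : gr.D r ∈ skF gr.m j := by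
  rw [D_eq]
  exact sum_mem fun d _ => Submodule.smul_mem _ _ (gr.pi_F j d hr)

theorem D_eig [CharZero k] (U : Submodule k R) (hU : ∀ u ∈ U, gr.D u ∈ U) (s : Finset ℕ)
    (v : ℕ → R) (hv : ∀ d, gr.D (v d) = (d : k) • v d) (hs : ∑ d ∈ s, v d ∈ U) :
    ∀ d ∈ s, v d ∈ U := by
  classical
  induction s using Finset.induction_on generalizing v with
  | empty => simp
  | insert e s he ih =>
    have h1 := sub_mem (hU _ hs) (U.smul_mem (e : k) hs)
    rw [map_sum, Finset.smul_sum, ← Finset.sum_sub_distrib, Finset.sum_insert he, hv, sub_self,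
      zero_add] at h1
    have h2 := ih (fun d => ((d : k) - e) • v d) (fun d => by
      rw [map_smul, hv, smul_comm]) (by
      convert h1 using 1
      refine Finset.sum_congr rfl fun d _ => ?_
      rw [hv, sub_smul])
    have h3 : ∀ d ∈ s, v d ∈ U := by
      intro d hd
      have hne : (d : k) - e ≠ 0 := by
        rw [sub_ne_zero]
        intro h
        have := Nat.cast_injective h
        subst this
        exact he hd
      exact (U.smul_mem_iff hne).1 (h2 d hd)
    intro d hd
    rw [Finset.mem_insert] at hd
    rcases hd with rfl | hd
    · rw [Finset.sum_insert he] at hs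
      have := sub_mem hs (sum_mem h3)
      simpa using this
    · exact h3 d hd

end SkGr

theorem skEv_g1 (hp : SkAnti p) (i : Fin n) :
    ∃ u : k, u ≠ 0 ∧ skEv hp (sgen p i) = Finsupp.single (Finsupp.single i 1) u := by
  refine ⟨skc p i 0 * 1, by simpa using skc_ne hp i 0, ?_⟩
  have := skEv_gen_mul hp i 1
  rw [mul_one] at this
  rw [this, skEv_one, skT_single, zero_add]

theorem skEv_g2 (hp : SkAnti p) (i j : Fin n) :
    ∃ u : k, u ≠ 0 ∧ skEv hp (sgen p i * sgen p j) =
      Finsupp.single (Finsupp.single j 1 + Finsupp.single i 1) u := by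
  obtain ⟨u, hu, e⟩ := skEv_g1 hp j
  refine ⟨skc p i (Finsupp.single j 1) * u, mul_ne_zero (skc_ne hp i _) hu, ?_⟩
  rw [skEv_gen_mul, e, skT_single]

theorem sgen_li (hp : SkAnti p) : LinearIndependent k (sgen p) := by
  rw [Fintype.linearIndependent_iff]
  intro c hc i
  choose u hu e using skEv_g1 hp
  have := DFunLike.congr_fun (congrArg (skEv hp) hc) (Finsupp.single i 1)
  rw [map_sum, map_zero, Finsupp.finsetSum_apply, Finset.sum_eq_single i] at this
  · rw [map_smul, e] at this
    simpa [hu i] using this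
  · intro j _ hj
    rw [map_smul, e, Finsupp.smul_single, Finsupp.single_apply, if_neg]
    intro h
    exact hj (Finsupp.single_left_injective one_ne_zero h)
  · simp

theorem sk_X_li (hp : SkAnti p) (Φ : SkewPoly k n p ≃ₐ[k] R) :
    LinearIndependent k (fun a => Φ (sgen p a)) :=
  (sgen_li hp).map' Φ.toLinearMap (LinearMap.ker_eq_bot.2 Φ.injective)

theorem sk_e2 {a b c d : Fin n} (h : Finsupp.single a 1 + Finsupp.single b 1 =
    (Finsupp.single c 1 + Finsupp.single d 1 : Fin n →₀ ℕ)) (hab : a ≠ c) : a = d ∧ b = c := by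
  have h1 := DFunLike.congr_fun h a
  have h2 := DFunLike.congr_fun h c
  simp only [Finsupp.add_apply, Finsupp.single_apply] at h1 h2
  constructor
  · by_contra h'
    rw [if_pos trivial, if_neg (Ne.symm hab), if_neg (Ne.symm h')] at h1
    omega
  · by_contra h'
    rw [if_pos trivial, if_neg hab, if_neg h'] at h2
    omega

theorem sk_block_aux {S : Type*} [Ring S] [Algebra k S] (x : Fin n → S) (hs : SkSys p x)
    (M : Fin n → Fin n → k) (a b : Fin n)
    (h : (∑ c, M c b • x c) * x a + x b * (∑ c, M c a • x c) =
      p a b • ((∑ c, M c a • x c) * x b + x a * (∑ c, M c b • x c))) :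
    ∑ c, (M c b * (p a c - p a b)) • (x a * x c) +
        ∑ c, (M c a * (p c b - p a b)) • (x c * x b) = 0 := by
  rw [← sub_eq_zero] at h
  rw [← h]
  simp only [Finset.sum_mul, Finset.mul_sum, smul_add, Finset.smul_sum, smul_mul_assoc,
    mul_smul_comm]
  have e1 : ∀ c, x c * x a = p a c • (x a * x c) := fun c => hs a c
  have e2 : ∀ c, x b * x c = p c b • (x c * x b) := fun c => hs c b
  simp only [← Finset.sum_add_distrib, ← Finset.sum_sub_distrib]
  refine Finset.sum_congr rfl fun c _ => ?_
  rw [e1 c, e2 c]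
  module

/-- linear derivations are block diagonal -/
theorem sk_block (hp : SkAnti p) (M : Fin n → Fin n → k)
    (hM : ∀ a b, (∑ c, M c b • sgen p c) * sgen p a + sgen p b * (∑ c, M c a • sgen p c) =
      p a b • ((∑ c, M c a • sgen p c) * sgen p b + sgen p a * (∑ c, M c b • sgen p c)))
    {b c : Fin n} (hcb : M c b ≠ 0) (a : Fin n) : p a c = p a b := by
  have key : ∀ a, a ≠ b → p a c = p a b := by
    intro a hab
    have h0 := sk_block_aux (sgen p) (sgen_sys hp) M a b (hM a b)
    choose u hu e using skEv_g2 hp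
    have h1 := DFunLike.congr_fun (congrArg (skEv hp) h0) (Finsupp.single c 1 + Finsupp.single a 1)
    rw [map_add (skEv hp), map_sum, map_sum, map_zero (skEv hp), Finsupp.add_apply, Finsupp.finsetSum_apply,
      Finsupp.finsetSum_apply, Finset.sum_eq_single c, Finset.sum_eq_zero] at h1
    · rw [map_smul, e, Finsupp.smul_single, Finsupp.single_eq_same, add_zero] at h1
      simp only [smul_eq_mul, Finsupp.coe_zero, Pi.zero_apply, mul_eq_zero, hcb, hu, or_false,
        false_or] at h1
      exact sub_eq_zero.1 h1
    · intro x _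
      rw [map_smul, e, Finsupp.smul_single, Finsupp.single_apply]
      split_ifs with hx
      · rw [add_comm (Finsupp.single c 1)] at hx
        obtain ⟨-, rfl⟩ := sk_e2 hx (Ne.symm hab)
        simp
      · rfl
    · intro x _ hx
      rw [map_smul, e, Finsupp.smul_single, Finsupp.single_apply, if_neg]
      intro h
      exact hx (Finsupp.single_left_injective one_ne_zero (add_right_cancel h))
    · simp
  by_cases hab : a = b
  · by_cases hcb' : c = b
    · rw [hcb']
    · have := key c hcb'
      have h2 := hp.2 c b
      rw [← this, hp.1, one_mul] at h2
      rw [hab, h2, hp.1]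
  · exact key a hab

end P5
end

noncomputable section
section P6
variable {k : Type*} [Field k] {R : Type*} [Ring R] [Algebra k R]
variable {n : ℕ} {p : Fin n → Fin n → k}

/-- replacing generators -/
theorem sk_replace {q : Fin n → Fin n → k} (hp : SkAnti p) (hq : SkAnti q) {m : Submodule k R}
    (hm : SkAug m) (Φ : SkewPoly k n p ≃ₐ[k] R) (hX : ∀ a, Φ (sgen p a) ∈ m)
    (g : SkewPoly k n q →ₐ[k] R) (hg : ∀ a, g (sgen q a) ∈ m) (hs : Function.Surjective g) :
    Function.Bijective g := by
  refine ⟨?_, hs⟩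
  have := sk_inj hp hq ((Φ.symm : R →ₐ[k] SkewPoly k n p).comp g) (fun i => by
    apply sk_equiv_m hm Φ hX
    simpa using hg i) (Φ.symm.surjective.comp hs)
  intro x y hxy
  apply this
  simp [hxy]

def skBlk (p : Fin n → Fin n → k) (X : Fin n → R) (b : Fin n) : Submodule k R :=
  Submodule.span k (X '' {c | ∀ a, p a c = p a b})

theorem skBlk_le {X : Fin n → R} {b c : Fin n} (h : ∀ a, p a c = p a b) :
    skBlk p X c ≤ skBlk p X b :=
  Submodule.span_mono (Set.image_mono fun _ hx a => (hx a).trans (h a))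

theorem skBlk_V {X : Fin n → R} {b : Fin n} : skBlk p X b ≤ Submodule.span k (Set.range X) :=
  Submodule.span_mono (Set.image_subset_range _ _)

theorem skBlk_skew (hp : SkAnti p) {X : Fin n → R} (hX : SkSys p X) {b b' : Fin n} {u v : R}
    (hu : u ∈ skBlk p X b) (hv : v ∈ skBlk p X b') : v * u = p b b' • (u * v) := by
  induction hu using Submodule.span_induction with
  | mem u hu =>
    obtain ⟨c, hc, rfl⟩ := hu
    induction hv using Submodule.span_induction with
    | mem v hv =>
      obtain ⟨c', hc', rfl⟩ := hv
      have h1 : p c c' = p b b' := by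
        rw [hc' c]
        have h2 := hp.2 b' c
        have h3 := hp.2 b' b
        rw [hc b', ← h3] at h2
        exact mul_left_cancel₀ (hp.ne _ _) h2
      rw [hX c c', h1]
    | zero => simp
    | add x y _ _ hx hy => rw [add_mul, mul_add, smul_add, hx, hy]
    | smul c x _ hx => rw [smul_mul_assoc, mul_smul_comm, hx, smul_comm]
  | zero => simp
  | add x y _ _ hx hy => rw [add_mul, mul_add, smul_add, hx, hy]
  | smul c x _ hx => rw [smul_mul_assoc, mul_smul_comm, hx, smul_comm]

variable {gr : SkGr k R}

theorem skD_X (hm : SkAug gr.m) (hp : SkAnti p) (Φ : SkewPoly k n p ≃ₐ[k] R)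
    (hX : ∀ a, Φ (sgen p a) ∈ gr.m) (b : Fin n) :
    gr.D (Φ (sgen p b)) ∈ skBlk p (fun a => Φ (sgen p a)) b ⊔ skF gr.m 2 := by
  have hX' := sk_X_adjoin Φ
  have hX1 : ∀ a, Φ (sgen p a) ∈ skF gr.m 1 := fun a => (skF_one hm).symm ▸ hX a
  have hch : ∀ b, ∃ M : Fin n → k, gr.D (Φ (sgen p b)) - ∑ c, M c • Φ (sgen p c) ∈ skF gr.m 2 := by
    intro b
    have h1 : gr.D (Φ (sgen p b)) ∈ gr.m := by
      rw [← skF_one hm]; exact gr.D_F 1 (hX1 b)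
    obtain ⟨v, hv, w, hw, e⟩ := Submodule.mem_sup.1 (sk_m_le hm hX hX' h1)
    obtain ⟨M, rfl⟩ := (Submodule.mem_span_range_iff_exists_fun k).1 hv
    exact ⟨M, by rw [← e, add_sub_cancel_left]; exact hw⟩
  choose M' hM using hch
  set M : Fin n → Fin n → k := fun c b => M' b c with hMdef
  set X := fun a => Φ (sgen p a) with hXd
  change ∀ b, gr.D (X b) - ∑ c, M c b • X c ∈ skF gr.m 2 at hM
  set v := fun b => ∑ c, M c b • X c with hv
  have hXV : ∀ a, X a ∈ Submodule.span k (Set.range X) := fun a => Submodule.subset_span ⟨a, rfl⟩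
  have hvV : ∀ b, v b ∈ Submodule.span k (Set.range X) := fun b =>
    sum_mem fun c _ => Submodule.smul_mem _ _ (hXV c)
  have hrel : ∀ a b, v b * X a + X b * v a = p a b • (v a * X b + X a * v b) := by
    intro a b
    rw [← sub_eq_zero]
    have h1 : ∀ a b, v b * X a + X b * v a ∈ Submodule.span k (Set.range X) ^ 2 := by
      intro a b
      rw [pow_two]
      exact add_mem (Submodule.mul_mem_mul (hvV b) (hXV a)) (Submodule.mul_mem_mul (hXV b) (hvV a))
    refine sk_hV hp hm Φ hX 2 (sub_mem (h1 a b) (Submodule.smul_mem _ _ (h1 b a))) ?_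
    have h2 : ∀ a b, gr.D (X b * X a) - (v b * X a + X b * v a) ∈ skF gr.m 3 := by
      intro a b
      rw [gr.D_mul, add_sub_add_comm, ← sub_mul, ← mul_sub]
      exact add_mem (skF_mul' hm (by norm_num) (hM b) (hX1 a))
        (skF_mul' hm (by norm_num) (hX1 b) (hM a))
    have h3 := sub_mem (Submodule.smul_mem _ (p a b) (h2 b a)) (h2 a b)
    rw [show X b * X a = p a b • (X a * X b) from sk_X_sys hp Φ a b, map_smul] at h3
    convert h3 using 1
    rw [smul_sub]; abel
  have hblk : ∀ {b c}, M c b ≠ 0 → ∀ a, p a c = p a b := by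
    intro b c hcb a
    refine sk_block hp M ?_ hcb a
    intro a b
    apply Φ.injective
    have := hrel a b
    simp only [hv, hXd] at this
    simpa only [map_add, map_mul, map_smul, map_sum] using this
  have hvb : v b ∈ skBlk p X b := ?_
  · have := add_mem (Submodule.mem_sup_left hvb) (Submodule.mem_sup_right (S := skBlk p X b) (hM b))
    rw [add_sub_cancel] at this
    exact this
  · refine sum_mem fun c _ => ?_
    by_cases h0 : M c b = 0
    · rw [h0, zero_smul]; exact zero_mem _
    · exact Submodule.smul_mem _ _ (Submodule.subset_span ⟨c, hblk h0, rfl⟩)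

theorem skD_stable (hm : SkAug gr.m) (hp : SkAnti p) (Φ : SkewPoly k n p ≃ₐ[k] R)
    (hX : ∀ a, Φ (sgen p a) ∈ gr.m) (b : Fin n) :
    ∀ u ∈ skBlk p (fun a => Φ (sgen p a)) b ⊔ skF gr.m 2,
      gr.D u ∈ skBlk p (fun a => Φ (sgen p a)) b ⊔ skF gr.m 2 := by
  have : skBlk p (fun a => Φ (sgen p a)) b ⊔ skF gr.m 2 ≤
      (skBlk p (fun a => Φ (sgen p a)) b ⊔ skF gr.m 2).comap gr.D := by
    refine sup_le ?_ ?_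
    · refine Submodule.span_le.2 ?_
      rintro _ ⟨c, hc, rfl⟩
      exact sup_le_sup_right (skBlk_le hc) _ (skD_X hm hp Φ hX c)
    · intro u hu
      exact Submodule.mem_sup_right (gr.D_F 2 hu)
  exact this

/-- the base step -/
theorem skBase [CharZero k] (hm : SkAug gr.m) (hp : SkAnti p) (Φ : SkewPoly k n p ≃ₐ[k] R)
    (hX : ∀ a, Φ (sgen p a) ∈ gr.m) :
    ∃ (q : Fin n → Fin n → k) (_ : SkAnti q) (Ψ : SkewPoly k n q ≃ₐ[k] R) (d : Fin n → ℕ),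
      (∀ a, Ψ (sgen q a) ∈ gr.m) ∧
      ∀ a, Ψ (sgen q a) - gr.pi (d a) (Ψ (sgen q a)) ∈ skF gr.m 2 := by
  have hX' := sk_X_adjoin Φ
  have hsys := sk_X_sys hp Φ
  have hpi : ∀ b d, gr.pi d (Φ (sgen p b)) ∈ skBlk p (fun a => Φ (sgen p a)) b ⊔ skF gr.m 2 := by
    intro b d
    by_cases hd : d ∈ (gr.θ (Φ (sgen p b))).support
    · refine gr.D_eig _ (skD_stable hm hp Φ hX b) (gr.θ (Φ (sgen p b))).support
        (fun d => gr.pi d (Φ (sgen p b))) (fun d => gr.D_pi d _) ?_ d hd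
      rw [gr.sum_pi]
      exact Submodule.mem_sup_left (Submodule.subset_span ⟨b, fun _ => rfl, rfl⟩)
    · rw [Polynomial.notMem_support_iff] at hd
      change gr.pi d _ = 0 at hd
      rw [hd]; exact zero_mem _
  set X := fun a => Φ (sgen p a) with hXd
  change ∀ a, X a ∈ gr.m at hX
  change ∀ b d, gr.pi d (X b) ∈ skBlk p X b ⊔ skF gr.m 2 at hpi
  have hch : ∀ x : Fin n × ℕ, ∃ l ∈ skBlk p X x.1, gr.pi x.2 (X x.1) - l ∈ skF gr.m 2 := by
    rintro ⟨b, d⟩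
    obtain ⟨v, hv, w, hw, e⟩ := Submodule.mem_sup.1 (hpi b d)
    exact ⟨v, hv, by simp only; rw [← e, add_sub_cancel_left]; exact hw⟩
  choose l hl hlF using hch
  have hXl : ∀ b, X b = ∑ d ∈ (gr.θ (X b)).support, l (b, d) := by
    intro b
    rw [← sub_eq_zero]
    refine sk_hV hp hm Φ hX 1 ?_ ?_
    · rw [pow_one]
      exact sub_mem (Submodule.subset_span ⟨b, rfl⟩) (sum_mem fun d _ => skBlk_V (hl (b, d)))
    · have : X b - ∑ d ∈ (gr.θ (X b)).support, l (b, d) =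
          ∑ d ∈ (gr.θ (X b)).support, (gr.pi d (X b) - l (b, d)) := by
        rw [Finset.sum_sub_distrib, gr.sum_pi]
      rw [this]
      exact sum_mem fun d _ => hlF (b, d)
  have hspan : Submodule.span k (Set.range l) = Submodule.span k (Set.range X) := by
    apply le_antisymm
    · refine Submodule.span_le.2 ?_
      rintro _ ⟨x, rfl⟩
      exact skBlk_V (hl x)
    · refine Submodule.span_le.2 ?_
      rintro _ ⟨b, rfl⟩
      rw [hXl b]
      exact sum_mem fun d _ => Submodule.subset_span ⟨_, rfl⟩
  obtain ⟨κ, J, hJ, hJs, hJl⟩ := exists_linearIndependent' k l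
  let b1 := (Module.Basis.span hJl).map (LinearEquiv.ofEq _ _ (hJs.trans hspan))
  let b2 := Module.Basis.span (sk_X_li hp Φ)
  let e : Fin n ≃ κ := b2.indexEquiv b1
  let J' : Fin n → Fin n × ℕ := J ∘ e
  let q : Fin n → Fin n → k := fun i j => p (J' i).1 (J' j).1
  have hq : SkAnti q := ⟨fun i => hp.1 _, fun i j => hp.2 _ _⟩
  have hY : SkSys q (fun i => l (J' i)) := fun i j => skBlk_skew hp hsys (hl _) (hl _)
  have hYm : ∀ i, l (J' i) ∈ gr.m := fun i => skV_le hX (skBlk_V (hl _))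
  have hYs : Submodule.span k (Set.range (fun i => l (J' i))) = Submodule.span k (Set.range X) := by
    rw [← hspan, ← hJs]
    congr 1
    exact e.surjective.range_comp (l ∘ J)
  have hsurj : Function.Surjective (slift (p := q) _ hY) := by
    rw [← AlgHom.range_eq_top, eq_top_iff, ← hX', Algebra.adjoin_le_iff]
    rintro _ ⟨a, rfl⟩
    have h1 : X a ∈ Submodule.span k (Set.range (fun i => l (J' i))) := by
      rw [hYs]; exact Submodule.subset_span ⟨a, rfl⟩
    have h2 : Submodule.span k (Set.range (fun i => l (J' i))) ≤
        Subalgebra.toSubmodule (slift (p := q) _ hY).range := by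
      refine Submodule.span_le.2 ?_
      rintro _ ⟨i, rfl⟩
      exact ⟨sgen q i, slift_gen _ _ _⟩
    exact h2 h1
  have hbij := sk_replace hp hq hm Φ hX (slift (p := q) _ hY) (fun a => by
    rw [slift_gen]; exact hYm a) hsurj
  have hgen : ∀ a, AlgEquiv.ofBijective _ hbij (sgen q a) = l (J' a) := fun a => by simp
  refine ⟨q, hq, AlgEquiv.ofBijective _ hbij, fun i => (J' i).2, ?_, ?_⟩
  · intro a; rw [hgen]; exact hYm a
  · intro a
    rw [hgen]
    have h1 := hlF (J' a)
    have h2 := gr.pi_F 2 (J' a).2 h1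
    rw [map_sub, gr.pi_self] at h2
    have := sub_mem h2 h1
    convert this using 1
    abel

/-- moving the origin -/
theorem skOrigin (hm : SkAug gr.m) (hp : SkAnti p) (Φ : SkewPoly k n p ≃ₐ[k] R) :
    ∃ Ψ : SkewPoly k n p ≃ₐ[k] R, ∀ a, Ψ (sgen p a) ∈ gr.m := by
  have hsys := sk_X_sys hp Φ
  choose c hc using fun a => hm.ex (Φ (sgen p a))
  have hne : ∀ a, Φ (sgen p a) ≠ 0 := fun a => (sk_X_li hp Φ).ne_zero a
  have key : ∀ a b, c a ≠ 0 → p a b = 1 := by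
    intro a b hca
    by_contra hpab
    have hrel : Φ (sgen p b) * Φ (sgen p a) = p a b • (Φ (sgen p a) * Φ (sgen p b)) := hsys a b
    set x := Φ (sgen p a) - algebraMap k R (c a) with hx
    have hxa : Φ (sgen p a) = x + algebraMap k R (c a) := by simp [hx]
    set y := Φ (sgen p b) with hy
    have h1 : (c a * (1 - p a b)) • y = p a b • (x * y) - y * x := by
      rw [hxa] at hrel
      rw [mul_add, add_mul, ← Algebra.commutes, ← Algebra.smul_def] at hrel
      have : y * x = p a b • (x * y + c a • y) - c a • y := by rw [← hrel]; abel
      rw [this]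
      module
    have hu : c a * (1 - p a b) ≠ 0 := mul_ne_zero hca (sub_ne_zero.2 (Ne.symm hpab))
    have hx1 : x ∈ skF gr.m 1 := (skF_one hm).symm ▸ hc a
    have hall : ∀ j, y ∈ skF gr.m j := by
      intro j
      induction j with
      | zero => trivial
      | succ j ih =>
        rw [← Submodule.smul_mem_iff _ hu, h1]
        exact sub_mem (Submodule.smul_mem _ _ (skF_mul' hm (by omega) hx1 ih))
          (skF_mul' hm (by omega) ih hx1)
    apply hne b
    change y = 0
    rw [← gr.sum_pi y]
    exact Finset.sum_eq_zero fun d _ => gr.pi_F_lt (d + 1) d (by omega) (hall _)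
  have key' : ∀ a b, c b ≠ 0 → p a b = 1 := by
    intro a b h
    have h2 := hp.2 b a
    rwa [key b a h, one_mul] at h2
  have hsh : ∀ e : k, SkSys p (fun a => sgen p a + algebraMap k (SkewPoly k n p) (e * c a)) := by
    intro e a b
    have h1 := sgen_sys hp a b
    simp only [add_mul, mul_add]
    rw [h1]
    have hgen : ∀ (x y : SkewPoly k n p) (s t : k),
        x * y + algebraMap k (SkewPoly k n p) t * x +
          (y * algebraMap k (SkewPoly k n p) s + algebraMap k _ t * algebraMap k _ s) =
        x * y + algebraMap k (SkewPoly k n p) s * y +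
          (x * algebraMap k (SkewPoly k n p) t + algebraMap k _ s * algebraMap k _ t) := by
      intro x y s t
      rw [Algebra.commutes t x, ← Algebra.commutes s y, ← map_mul, ← map_mul, mul_comm t s]
      abel
    by_cases ha : c a = 0
    · by_cases hb : c b = 0
      · simp [ha, hb]
      · rw [key' a b hb, one_smul, one_smul]
        exact hgen _ _ _ _
    · rw [key a b ha, one_smul, one_smul]
      exact hgen _ _ _ _
  have hcomp : ∀ e, (slift _ (hsh (-e))).comp (slift _ (hsh e)) = AlgHom.id k (SkewPoly k n p) := by
    intro e
    apply shom_ext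
    intro a
    simp [AlgHom.commutes]
  let σ : SkewPoly k n p ≃ₐ[k] SkewPoly k n p := AlgEquiv.ofAlgHom (slift _ (hsh (-1)))
    (slift _ (hsh 1)) (hcomp 1) (by simpa using hcomp (-1))
  refine ⟨σ.trans Φ, fun a => ?_⟩
  have : σ (sgen p a) = sgen p a + algebraMap k (SkewPoly k n p) (-1 * c a) := by
    simp only [σ, AlgEquiv.ofAlgHom_apply, slift_gen]
  rw [AlgEquiv.trans_apply, this, map_add, AlgEquiv.commutes]
  convert hc a using 1
  simp [sub_eq_add_neg]

end P6
end

noncomputable section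
section P7
open Polynomial
variable {k : Type*} [Field k] {n : ℕ} {p : Fin n → Fin n → k}

def skHat (p : Fin n → Fin n → k) : Fin (n + 1) → Fin (n + 1) → k := fun i j =>
  Fin.lastCases (motive := fun _ => k) 1
    (fun i => Fin.lastCases (motive := fun _ => k) 1 (fun j => p i j) j) i

@[simp] theorem skHat_cc (i j : Fin n) : skHat p i.castSucc j.castSucc = p i j := by simp [skHat]
@[simp] theorem skHat_lr (j : Fin (n + 1)) : skHat p (Fin.last n) j = 1 := by simp [skHat]
@[simp] theorem skHat_rl (j : Fin (n + 1)) : skHat p j (Fin.last n) = 1 := by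
  induction j using Fin.lastCases with
  | last => simp
  | cast j => simp [skHat]

theorem skHat_anti (hp : SkAnti p) : SkAnti (skHat p) := by
  constructor
  · intro i
    induction i using Fin.lastCases with
    | last => simp
    | cast i => simp [hp.1]
  · intro i j
    induction i using Fin.lastCases with
    | last => simp
    | cast i =>
      induction j using Fin.lastCases with
      | last => simp
      | cast j => simp [hp.2]

def skY (p : Fin n → Fin n → k) : Fin (n + 1) → (SkewPoly k n p)[X] :=
  fun i => Fin.lastCases (motive := fun _ => (SkewPoly k n p)[X]) X (fun i => C (sgen p i)) i

@[simp] theorem skY_last : skY p (Fin.last n) = X := by simp [skY]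
@[simp] theorem skY_cast (i : Fin n) : skY p i.castSucc = C (sgen p i) := by simp [skY]

theorem skY_sys (hp : SkAnti p) : SkSys (skHat p) (skY p) := by
  intro i j
  induction i using Fin.lastCases with
  | last => simp [X_mul]
  | cast i =>
    induction j using Fin.lastCases with
    | last => simp [X_mul]
    | cast j =>
      simp only [skY_cast, skHat_cc]
      rw [← C_mul, ← C_mul, sgen_sys hp i j, smul_C]

theorem sk_inc_sys (hp : SkAnti p) : SkSys p (fun i : Fin n => sgen (skHat p) i.castSucc) := by
  intro i j
  have := sgen_sys (skHat_anti hp) i.castSucc j.castSucc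
  simpa using this

theorem sk_inc_comm (hp : SkAnti p) (r : SkewPoly k n p) :
    Commute (slift _ (sk_inc_sys hp) r) (sgen (skHat p) (Fin.last n)) := by
  refine sk_ind (P := fun r => Commute (slift _ (sk_inc_sys hp) r) (sgen (skHat p) (Fin.last n)))
    (sgen_adjoin (p := p)) ?_ ?_ ?_ ?_ r
  · intro a
    rw [slift_gen]
    have := sgen_sys (skHat_anti hp) (Fin.last n) a.castSucc
    rw [skHat_lr, one_smul] at this
    exact this
  · intro c
    rw [AlgHom.commutes]
    exact Algebra.commutes _ _
  · intro a b ha hb; rw [map_add]; exact ha.add_left hb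
  · intro a b ha hb; rw [map_mul]; exact ha.mul_left hb

def skEvalHom {S T : Type*} [Ring S] [Algebra k S] [Ring T] [Algebra k T] (f : S →ₐ[k] T) (t : T)
    (h : ∀ a, Commute (f a) t) : S[X] →ₐ[k] T where
  __ := eval₂RingHom' (f : S →+* T) t h
  commutes' c := by
    change eval₂ _ _ (algebraMap k S[X] c) = _
    rw [Polynomial.algebraMap_apply, eval₂_C]
    exact f.commutes c

@[simp] theorem skEvalHom_C {S T : Type*} [Ring S] [Algebra k S] [Ring T] [Algebra k T]
    (f : S →ₐ[k] T) (t : T) (h : ∀ a, Commute (f a) t) (a : S) : skEvalHom f t h (C a) = f a :=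
  eval₂_C _ _

@[simp] theorem skEvalHom_X {S T : Type*} [Ring S] [Algebra k S] [Ring T] [Algebra k T]
    (f : S →ₐ[k] T) (t : T) (h : ∀ a, Commute (f a) t) : skEvalHom f t h X = t :=
  eval₂_X _ _

theorem sk_poly_ext {S T : Type*} [Ring S] [Algebra k S] [Ring T] [Algebra k T]
    {f g : S[X] →ₐ[k] T} (hC : ∀ a, f (C a) = g (C a)) (hX : f X = g X) : f = g := by
  apply Polynomial.algHom_ext'
  · ext a
    exact hC a
  · exact hX

def skPolyEquiv (hp : SkAnti p) : SkewPoly k (n + 1) (skHat p) ≃ₐ[k] (SkewPoly k n p)[X] :=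
  AlgEquiv.ofAlgHom (slift _ (skY_sys hp))
    (skEvalHom (slift _ (sk_inc_sys hp)) (sgen (skHat p) (Fin.last n)) (sk_inc_comm hp))
    (by
      refine sk_poly_ext (k := k) (S := SkewPoly k n p) (T := (SkewPoly k n p)[X]) ?_ ?_
      · intro a
        rw [AlgHom.comp_apply, skEvalHom_C]
        refine sk_ind (P := fun a => slift (skY p) (skY_sys hp) (slift _ (sk_inc_sys hp) a) = C a)
          (sgen_adjoin (p := p)) ?_ ?_ ?_ ?_ a
        · intro i; simp
        · intro c; rw [AlgHom.commutes, AlgHom.commutes]; rfl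
        · intro a b ha hb; rw [map_add, map_add, ha, hb, C_add]
        · intro a b ha hb; rw [map_mul, map_mul, ha, hb, C_mul]
      · rw [AlgHom.comp_apply, skEvalHom_X]; simp)
    (by
      apply shom_ext
      intro i
      induction i using Fin.lastCases with
      | last => simp
      | cast i => simp)

theorem skPolyEquiv_cast (hp : SkAnti p) (i : Fin n) :
    skPolyEquiv hp (sgen _ i.castSucc) = C (sgen p i) := by
  simp [skPolyEquiv]

theorem skPolyEquiv_last (hp : SkAnti p) :
    skPolyEquiv hp (sgen _ (Fin.last n)) = X := by
  simp [skPolyEquiv]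

variable {B : Type*} [Ring B] [Algebra k B]

section base
variable (ℬ : ℕ → Submodule k B) [GradedAlgebra ℬ]

def skMon (i : ℕ) : ℬ i →ₗ[k] B[X] := ((monomial i : B →ₗ[B] B[X]).restrictScalars k) ∘ₗ (ℬ i).subtype

theorem skMon_one : skMon ℬ 0 (GradedMonoid.GOne.one (A := fun i => ℬ i)) = 1 := by
  change monomial 0 (1 : B) = 1
  exact monomial_zero_one

theorem skMon_mul {i j : ℕ} (x : ℬ i) (y : ℬ j) :
    skMon ℬ (i + j) (GradedMonoid.GMul.mul (A := fun i => ℬ i) x y) =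
      skMon ℬ i x * skMon ℬ j y := by
  change monomial (i + j) ((x : B) * (y : B)) = monomial i (x : B) * monomial j (y : B)
  exact (monomial_mul_monomial _ _ _ _).symm

def skTh : B →ₐ[k] B[X] :=
  (DirectSum.toAlgebra k (fun i => ℬ i) (skMon ℬ) (skMon_one ℬ)
    (fun x y => skMon_mul ℬ x y)).comp
    (DirectSum.decomposeAlgEquiv ℬ : B →ₐ[k] _)

theorem skTh_of {i : ℕ} {b : B} (hb : b ∈ ℬ i) : skTh ℬ b = monomial i b := by
  simp only [skTh, AlgHom.comp_apply]
  change DirectSum.toAlgebra k (fun i => ℬ i) (skMon ℬ) _ _ (DirectSum.decompose ℬ b) = _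
  lift b to ℬ i using hb
  rw [DirectSum.decompose_coe]
  refine (DirectSum.toSemiring_of (A := fun i => ℬ i)
    (fun i => (skMon ℬ i).toAddMonoidHom) (skMon_one ℬ) (fun x y => skMon_mul ℬ x y) i b).trans ?_
  rfl

theorem skB_ind {P : B → Prop} (h : ∀ i b, b ∈ ℬ i → P b) (ha : ∀ a b, P a → P b → P (a + b))
    (b : B) : P b := by
  refine DirectSum.Decomposition.inductionOn ℬ (motive := P) ?_ ?_ ?_ b
  · exact h 0 0 (zero_mem _)
  · intro i m; exact h i m m.2
  · exact ha

def skGrB (hconn : ∀ b ∈ ℬ 0, ∃ c : k, b = algebraMap k B c) : SkGr k B where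
  θ := skTh ℬ
  c1 r d := by
    refine skB_ind ℬ (P := fun r => skTh ℬ ((skTh ℬ r).coeff d) = monomial d ((skTh ℬ r).coeff d))
      ?_ ?_ r
    · intro i b hb
      rw [skTh_of ℬ hb, coeff_monomial]
      split_ifs with h
      · rw [skTh_of ℬ hb, h]
      · simp
    · intro a b ha hb
      simp [ha, hb]
  c2 r := by
    rw [← skEps_sum]
    refine skB_ind ℬ (P := fun r => skEps B (skTh ℬ r) = r) ?_ ?_ r
    · intro i b hb
      rw [skTh_of ℬ hb, skEps_monomial]
    · intro a b ha hb
      rw [map_add, map_add, ha, hb]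
  c3 r := by
    refine skB_ind ℬ (P := fun r => ∃ c : k, (skTh ℬ r).coeff 0 = algebraMap k B c) ?_ ?_ r
    · intro i b hb
      rw [skTh_of ℬ hb, coeff_monomial]
      split_ifs with h
      · subst h; exact hconn b hb
      · exact ⟨0, by simp⟩
    · rintro a b ⟨c, hc⟩ ⟨c', hc'⟩
      exact ⟨c + c', by rw [map_add, coeff_add, hc, hc', map_add]⟩

end base

namespace SkGr
variable (g : SkGr k B)

theorem ind {P : B → Prop} (h : ∀ i b, g.pi i b = b → P b) (ha : ∀ a b, P a → P b → P (a + b))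
    (b : B) : P b := by
  rw [← g.sum_pi b]
  refine Finset.sum_induction _ P ha (h 0 0 (map_zero _)) ?_
  intro d _
  exact h d _ (g.pi_self d b)

theorem map_C_comm (f : B[X]) : Commute (mapRingHom (C : B →+* B[X]) f) (C X) := by
  induction f using Polynomial.induction_on' with
  | add f g hf hg => rw [map_add]; exact hf.add_left hg
  | monomial n a =>
    rw [coe_mapRingHom, map_monomial]
    change monomial n (C a) * C X = C X * monomial n (C a)
    rw [monomial_mul_C, C_mul_monomial, X_mul]

def polyθ : B[X] →ₐ[k] B[X][X] :=
  skEvalHom ((mapAlgHom (CAlgHom : B →ₐ[k] B[X])).comp g.θ) (C X * X) (fun a =>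
    (map_C_comm (g.θ a)).mul_right (X_mul (p := _)).symm)

theorem polyθ_C (b : B) : g.polyθ (C b) = map C (g.θ b) := by
  exact skEvalHom_C _ _ _ _

theorem polyθ_X : g.polyθ X = monomial 1 X := by
  simp [polyθ, C_mul_X_eq_monomial]

theorem polyθ_hom {i : ℕ} {b : B} (hb : g.pi i b = b) (j : ℕ) :
    g.polyθ (C b * X ^ j) = monomial (i + j) (C b * X ^ j) := by
  rw [map_mul, map_pow, polyθ_C, polyθ_X, g.θ_of_pi hb, map_monomial, monomial_pow,
    monomial_mul_monomial, one_mul]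

theorem poly_ind {P : B[X] → Prop} (h : ∀ i j b, g.pi i b = b → P (C b * X ^ j))
    (ha : ∀ a b, P a → P b → P (a + b)) (r : B[X]) : P r := by
  induction r using Polynomial.induction_on' with
  | add a b hp hq => exact ha a b hp hq
  | monomial j b =>
    refine g.ind (P := fun b => P (monomial j b)) ?_ ?_ b
    · intro i b hb
      rw [← C_mul_X_pow_eq_monomial]
      exact h i j b hb
    · intro a b hp hq
      rw [map_add]; exact ha _ _ hp hq

def poly : SkGr k B[X] where
  θ := g.polyθ
  c1 r d := by
    refine g.poly_ind (P := fun r => g.polyθ ((g.polyθ r).coeff d) =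
      monomial d ((g.polyθ r).coeff d)) ?_ ?_ r
    · intro i j b hb
      rw [g.polyθ_hom hb, coeff_monomial]
      split_ifs with h
      · rw [g.polyθ_hom hb, h]
      · simp
    · intro a b ha hb
      simp [ha, hb]
  c2 r := by
    rw [← skEps_sum]
    refine g.poly_ind (P := fun r => skEps _ (g.polyθ r) = r) ?_ ?_ r
    · intro i j b hb
      rw [g.polyθ_hom hb, skEps_monomial]
    · intro a b ha hb
      rw [map_add, map_add, ha, hb]
  c3 r := by
    refine g.poly_ind (P := fun r => ∃ c : k, (g.polyθ r).coeff 0 = algebraMap k _ c) ?_ ?_ r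
    · intro i j b hb
      rw [g.polyθ_hom hb, coeff_monomial]
      split_ifs with h
      · obtain ⟨rfl, rfl⟩ : i = 0 ∧ j = 0 := by omega
        obtain ⟨c, hc⟩ := g.c3 b
        change g.pi 0 b = _ at hc
        rw [hb] at hc
        exact ⟨c, by rw [hc, pow_zero, mul_one]; rfl⟩
      · exact ⟨0, by simp⟩
    · rintro a b ⟨c, hc⟩ ⟨c', hc'⟩
      exact ⟨c + c', by rw [map_add, coeff_add, hc, hc', map_add]⟩

theorem poly_pi_C (d : ℕ) (b : B) : g.poly.pi d (C b) = C (g.pi d b) := by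
  change (g.polyθ (C b)).coeff d = _
  rw [polyθ_C, coeff_map]
  rfl

theorem poly_pi_X (d : ℕ) : g.poly.pi d X = if 1 = d then X else 0 := by
  change (g.polyθ X).coeff d = _
  rw [polyθ_X, coeff_monomial]

theorem poly_pi_coeff (d : ℕ) (r : B[X]) : g.pi d (r.coeff 0) = (g.poly.pi d r).coeff 0 := by
  refine g.poly_ind (P := fun r => g.pi d (r.coeff 0) = (g.poly.pi d r).coeff 0) ?_ ?_ r
  · intro i j b hb
    change _ = ((g.polyθ _).coeff d).coeff 0
    rw [g.polyθ_hom hb, coeff_monomial]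
    cases j with
    | zero =>
      simp only [pow_zero, mul_one, coeff_C_zero, add_zero]
      rw [← hb, g.pi_pi, hb]
      split_ifs <;> simp
    | succ j =>
      have : (C b * X ^ (j + 1)).coeff 0 = 0 := by simp
      rw [this, map_zero]
      split_ifs <;> simp
  · intro a b ha hb
    rw [coeff_add, map_add, ha, hb, map_add, coeff_add]

end SkGr

end P7
end

noncomputable section
section P8
open Polynomial
variable {k : Type*} [Field k]

theorem skF_gen {R : Type*} [Ring R] [Algebra k R] {m : Submodule k R} (hm : SkAug m)
    (S : Subalgebra k R) (hS : ∀ b ∈ m, ∃ v ∈ S, b - v ∈ skF m 2) (j : ℕ) :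
    ∀ r ∈ skF m j, ∃ s ∈ S, r - s ∈ skF m (j + 1) := by
  induction j with
  | zero =>
    intro r _
    obtain ⟨c, hc⟩ := hm.ex r
    exact ⟨_, S.algebraMap_mem c, by rw [skF_one hm]; exact hc⟩
  | succ j ih =>
    intro r hr
    induction hr using Submodule.mul_induction_on' with
    | mem_mul_mem a ha b hb =>
      obtain ⟨s, hs, h1⟩ := ih a ha
      obtain ⟨v, hv, h2⟩ := hS b hb
      refine ⟨s * v, S.mul_mem hs hv, ?_⟩
      have h3 : s ∈ skF m j := by
        have := sub_mem ha (skF_succ_le hm j h1)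
        rwa [sub_sub_cancel] at this
      have h4 : a * b - s * v = s * (b - v) + (a - s) * b := by noncomm_ring
      rw [h4]
      refine add_mem (skF_mul' hm (by omega) h3 h2) ?_
      rw [← skF_one hm] at hb
      exact skF_mul' hm (by omega) h1 hb
    | add x _ y _ hx hy =>
      obtain ⟨s, hs, h1⟩ := hx
      obtain ⟨t, ht, h2⟩ := hy
      exact ⟨s + t, S.add_mem hs ht, by rw [add_sub_add_comm]; exact add_mem h1 h2⟩

theorem skF_gen' {R : Type*} [Ring R] [Algebra k R] {m : Submodule k R} (hm : SkAug m)
    (S : Subalgebra k R) (hS : ∀ b ∈ m, ∃ v ∈ S, b - v ∈ skF m 2) (j : ℕ) (r : R) :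
    ∃ s ∈ S, r - s ∈ skF m j := by
  induction j with
  | zero => exact ⟨0, S.zero_mem, trivial⟩
  | succ j ih =>
    obtain ⟨s, hs, h1⟩ := ih
    obtain ⟨t, ht, h2⟩ := skF_gen hm S hS j _ h1
    exact ⟨s + t, S.add_mem hs ht, by rwa [← sub_sub]⟩

theorem skGen {R : Type*} [Ring R] [Algebra k R] {gr : SkGr k R} (hm : SkAug gr.m) {n : ℕ}
    {y : Fin n → R} {d : Fin n → ℕ} (hd : ∀ i, gr.pi (d i) (y i) = y i)
    (hy : gr.m ≤ Submodule.span k (Set.range y) ⊔ skF gr.m 2) :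
    Algebra.adjoin k (Set.range y) = ⊤ := by
  set S := Algebra.adjoin k (Set.range y) with hSdef
  have hS : ∀ b ∈ gr.m, ∃ v ∈ S, b - v ∈ skF gr.m 2 := by
    intro b hb
    obtain ⟨v, hv, w, hw, rfl⟩ := Submodule.mem_sup.1 (hy hb)
    refine ⟨v, Algebra.span_le_adjoin k _ hv, by rwa [add_sub_cancel_left]⟩
  have hpi : ∀ s ∈ S, ∀ e, gr.pi e s ∈ S := by
    intro s hs
    induction hs using Algebra.adjoin_induction with
    | mem x hx =>
      obtain ⟨i, rfl⟩ := hx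
      intro e
      rw [← hd i, gr.pi_pi]
      split_ifs
      · rw [hd]; exact Algebra.subset_adjoin ⟨i, rfl⟩
      · exact S.zero_mem
    | algebraMap c =>
      intro e
      rw [← gr.pi_zero_alg, gr.pi_pi]
      split_ifs
      · rw [gr.pi_zero_alg]; exact S.algebraMap_mem c
      · exact S.zero_mem
    | add x y _ _ hx hy => intro e; rw [map_add]; exact S.add_mem (hx e) (hy e)
    | mul x y _ _ hx hy =>
      intro e
      rw [gr.pi_mul]
      exact S.sum_mem fun z _ => S.mul_mem (hx _) (hy _)
  rw [eq_top_iff]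
  intro r _
  rw [← gr.sum_pi r]
  refine S.sum_mem fun e _ => ?_
  obtain ⟨s, hs, h1⟩ := skF_gen' hm S hS (e + 1) r
  have h2 := gr.pi_F_lt (e + 1) e (Nat.lt_succ_self e) h1
  rw [map_sub, sub_eq_zero] at h2
  rw [h2]
  exact hpi s hs e

variable {B : Type*} [Ring B] [Algebra k B]

def skC0 (k : Type*) [Field k] (B : Type*) [Ring B] [Algebra k B] : B[X] →ₐ[k] B where
  __ := (constantCoeff : B[X] →+* B)
  commutes' c := by
    change (algebraMap k B[X] c).coeff 0 = _
    rw [Polynomial.algebraMap_apply, coeff_C_zero]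

theorem skC0_apply (r : B[X]) : skC0 k B r = r.coeff 0 := rfl

theorem skC0_m (g : SkGr k B) {r : B[X]} (hr : r ∈ g.poly.m) : skC0 k B r ∈ g.m := by
  rw [SkGr.mem_m] at *
  rw [skC0_apply, g.poly_pi_coeff, hr, coeff_zero]

theorem skC0_F (g : SkGr k B) (j : ℕ) {r : B[X]} (hr : r ∈ skF g.poly.m j) :
    skC0 k B r ∈ skF g.m j := by
  induction j generalizing r with
  | zero => trivial
  | succ j ih =>
    induction hr using Submodule.mul_induction_on' with
    | mem_mul_mem x hx y hy =>
      rw [map_mul]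
      exact Submodule.mul_mem_mul (ih hx) (skC0_m g hy)
    | add x _ y _ hx hy => rw [map_add]; exact add_mem hx hy

theorem skMain {n : ℕ} [CharZero k] {p : Fin n → Fin n → k} (hp : SkAnti p) (g : SkGr k B)
    (Θ : (SkewPoly k n p)[X] ≃ₐ[k] B[X]) :
    ∃ q : Fin n → Fin n → k, SkAnti q ∧ Nonempty (B ≃ₐ[k] SkewPoly k n q) := by
  have hnt0 : Nontrivial (SkewPoly k n p) := (sAug p : SkewPoly k n p →+* k).domain_nontrivial
  have hnt1 : Nontrivial B[X] := Θ.symm.toRingEquiv.toEquiv.nontrivial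
  have hnt : Nontrivial B := (C : B →+* B[X]).domain_nontrivial
  have hm : SkAug g.poly.m := g.poly.aug
  have hm0 : SkAug g.m := g.aug
  obtain ⟨Ψ0, hΨ0⟩ := skOrigin hm (skHat_anti hp) ((skPolyEquiv hp).trans Θ)
  obtain ⟨q', hq', Ψ, d, hΨ, hd⟩ := skBase hm (skHat_anti hp) Ψ0 hΨ0
  obtain ⟨z, hz, hzΨ, hzs⟩ := skHomog hm hq' Ψ hΨ hd
  have hzm : ∀ a, z a ∈ g.poly.m := by
    intro a
    have h1 : skF g.poly.m 2 ≤ g.poly.m := by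
      have := skF_succ_le hm 1
      rwa [skF_one hm] at this
    have := add_mem (h1 (hzΨ a)) (hΨ a)
    rwa [sub_add_cancel] at this
  have hmz : g.poly.m ≤ Submodule.span k (Set.range z) ⊔ skF g.poly.m 2 := by
    refine (sk_m_le hm hΨ (sk_X_adjoin Ψ)).trans (sup_le ?_ le_sup_right)
    rw [Submodule.span_le]
    rintro _ ⟨a, rfl⟩
    have h1 : Ψ (sgen q' a) = z a + -(z a - Ψ (sgen q' a)) := by abel
    simp only
    rw [h1]
    exact Submodule.add_mem_sup (Submodule.subset_span ⟨a, rfl⟩) (neg_mem (hzΨ a))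
  have hXm : (X : B[X]) ∈ g.poly.m := by
    rw [SkGr.mem_m, g.poly_pi_X]; simp
  obtain ⟨v, hv, w, hw, hvw⟩ := Submodule.mem_sup.1 (hmz hXm)
  obtain ⟨c, rfl⟩ := (Submodule.mem_span_range_iff_exists_fun k).1 hv
  obtain ⟨j0, hj0⟩ : ∃ j0, c j0 ≠ 0 := by
    by_contra! h
    simp only [h, zero_smul, Finset.sum_const_zero, zero_add] at hvw
    have := g.poly.pi_F_lt 2 1 (by norm_num) hw
    rw [hvw, g.poly_pi_X] at this
    simp at this
  let b : Fin (n + 1) → B := fun a => skC0 k B (z a)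
  let y : Fin n → B := fun i => b (j0.succAbove i)
  have hb : ∀ a, g.pi (d a) (b a) = b a := by
    intro a
    change g.pi (d a) ((z a).coeff 0) = (z a).coeff 0
    rw [g.poly_pi_coeff, hz]
  have hbm : ∀ a, b a ∈ g.m := fun a => skC0_m g (hzm a)
  let V : Submodule k B := Submodule.span k (Set.range y) ⊔ skF g.m 2
  have hyV : ∀ i, b (j0.succAbove i) ∈ V := fun i =>
    Submodule.mem_sup_left (Submodule.subset_span ⟨i, rfl⟩)
  have hbV : ∀ a, b a ∈ V := by
    intro a
    rcases Fin.eq_self_or_eq_succAbove j0 a with rfl | ⟨i, rfl⟩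
    · have h1 := congrArg (skC0 k B) hvw
      have h2 : skC0 k B X = 0 := coeff_X_zero
      rw [h2, map_add, map_sum, Fin.sum_univ_succAbove _ a] at h1
      simp only [map_smul] at h1
      have h3 : c a • b a = -(∑ i, c (a.succAbove i) • b (a.succAbove i) + skC0 k B w) := by
        rw [eq_neg_iff_add_eq_zero, ← add_assoc]
        exact h1
      have h4 : c a • b a ∈ V := by
        rw [h3]
        exact neg_mem (add_mem (sum_mem fun i _ => V.smul_mem _ (hyV i))
          (Submodule.mem_sup_right (skC0_F g 2 hw)))
      exact (V.smul_mem_iff hj0).1 h4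
    · exact hyV i
  have hgV : g.m ≤ V := by
    intro x hx
    have h1 : C x ∈ g.poly.m := by
      rw [SkGr.mem_m] at *
      rw [g.poly_pi_C, hx, C_0]
    obtain ⟨v, hv, w, hw, hvw⟩ := Submodule.mem_sup.1 (hmz h1)
    obtain ⟨c, rfl⟩ := (Submodule.mem_span_range_iff_exists_fun k).1 hv
    have h2 := congrArg (skC0 k B) hvw
    have h3 : skC0 k B (C x) = x := coeff_C_zero
    rw [h3, map_add, map_sum] at h2
    rw [← h2]
    refine add_mem (sum_mem fun i _ => ?_) (Submodule.mem_sup_right (skC0_F g 2 hw))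
    rw [map_smul]
    exact V.smul_mem _ (hbV i)
  have hadj : Algebra.adjoin k (Set.range y) = ⊤ :=
    skGen hm0 (d := fun i => d (j0.succAbove i)) (fun i => hb _) hgV
  let q : Fin n → Fin n → k := fun i j => q' (j0.succAbove i) (j0.succAbove j)
  have hq : SkAnti q := ⟨fun i => hq'.1 _, fun i j => hq'.2 _ _⟩
  have hys : SkSys q y := by
    intro i j
    change skC0 k B _ * skC0 k B _ = _ • (skC0 k B _ * skC0 k B _)
    rw [← map_mul, hzs, map_smul, map_mul]
  let ψ : SkewPoly k n q →ₐ[k] B := slift y hys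
  have hψs : Function.Surjective ψ := by
    rw [← AlgHom.range_eq_top, eq_top_iff, ← hadj, Algebra.adjoin_le_iff]
    rintro _ ⟨i, rfl⟩
    exact ⟨sgen q i, slift_gen _ _ _⟩
  have hmaps : Function.Surjective (mapAlgHom ψ) := map_surjective (ψ : SkewPoly k n q →+* B) hψs
  have hbij := sk_replace hq' (skHat_anti hq) hm Ψ hΨ
    ((mapAlgHom ψ).comp (skPolyEquiv hq : SkewPoly k (n + 1) (skHat q) →ₐ[k] _)) (by
      intro a
      induction a using Fin.lastCases with
      | last =>
        have : ((mapAlgHom ψ).comp (skPolyEquiv hq : SkewPoly k (n + 1) (skHat q) →ₐ[k] _))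
            (sgen _ (Fin.last n)) = X := by
          change mapAlgHom ψ (skPolyEquiv hq (sgen _ (Fin.last n))) = X
          rw [skPolyEquiv_last]
          exact map_X _
        rw [this]; exact hXm
      | cast i =>
        have : ((mapAlgHom ψ).comp (skPolyEquiv hq : SkewPoly k (n + 1) (skHat q) →ₐ[k] _))
            (sgen _ i.castSucc) = C (y i) := by
          change mapAlgHom ψ (skPolyEquiv hq (sgen _ i.castSucc)) = C (y i)
          rw [skPolyEquiv_cast]
          refine (map_C _).trans ?_
          exact congrArg C (slift_gen _ _ _)
        rw [this, SkGr.mem_m, g.poly_pi_C, (g.mem_m _).1 (hbm _), C_0])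
    (by
      intro r
      obtain ⟨s, hs⟩ := hmaps r
      obtain ⟨t, rfl⟩ := (skPolyEquiv hq).surjective s
      exact ⟨t, hs⟩)
  have hψi : Function.Injective ψ := by
    intro s t hst
    have h1 : mapAlgHom ψ (C s) = mapAlgHom ψ (C t) :=
      (map_C (ψ : SkewPoly k n q →+* B)).trans
        ((congrArg C hst).trans (map_C (ψ : SkewPoly k n q →+* B)).symm)
    have h2 := hbij.1 (a₁ := (skPolyEquiv hq).symm (C s)) (a₂ := (skPolyEquiv hq).symm (C t)) (by
      change mapAlgHom ψ (skPolyEquiv hq _) = mapAlgHom ψ (skPolyEquiv hq _)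
      rw [AlgEquiv.apply_symm_apply, AlgEquiv.apply_symm_apply]
      exact h1)
    exact C_injective ((skPolyEquiv hq).symm.injective h2)
  exact ⟨q, hq, ⟨(AlgEquiv.ofBijective ψ ⟨hψi, hψs⟩).symm⟩⟩

end P8
end


/-- Suppose `k` is algebraically closed of characteristic 0. Let
`A = k_p[x,y,z]` be a PI skew polynomial ring in three variables (all `p_{ij}` roots
of unity) and let `B` be a connected `ℕ`-graded `k`-algebra (not necessarily generated
in degree one). If `A[t] ≅ B[t]` as `k`-algebras, then `B` is isomorphic to a skew
polynomial ring `k_q[u_1,u_2,u_3]`. -/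
theorem stmt17 (k : Type*) [Field k] [CharZero k] [IsAlgClosed k]
    (p : Fin 3 → Fin 3 → k)
    (hp1 : ∀ i, p i i = 1) (hp2 : ∀ i j, p j i = (p i j)⁻¹)
    (hroot : ∀ i j, ∃ m : ℕ, 0 < m ∧ p i j ^ m = 1)
    (B : Type*) [Ring B] [Algebra k B]
    (ℬ : ℕ → Submodule k B) [GradedAlgebra ℬ]
    (hconn : ∀ b ∈ ℬ 0, ∃ c : k, b = algebraMap k B c)
    (hfd : ∀ i, Module.Finite k ↥(ℬ i))
    (hiso : Nonempty (Polynomial (SkewPoly k 3 p) ≃ₐ[k] Polynomial B)) :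
    ∃ q : Fin 3 → Fin 3 → k,
      (∀ i, q i i = 1) ∧ (∀ i j, q j i = (q i j)⁻¹) ∧
      Nonempty (B ≃ₐ[k] SkewPoly k 3 q) := by
  have hp : SkAnti p := by
    refine ⟨hp1, fun i j => ?_⟩
    obtain ⟨m, hm, h⟩ := hroot i j
    have h0 : p i j ≠ 0 := by
      intro h0
      rw [h0, zero_pow hm.ne'] at h
      exact zero_ne_one h
    rw [hp2 i j, mul_inv_cancel₀ h0]
  obtain ⟨Θ⟩ := hiso
  obtain ⟨q, hq, he⟩ := skMain hp (skGrB ℬ hconn) Θ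
  exact ⟨q, hq.1, fun i j => eq_inv_of_mul_eq_one_right (hq.2 i j), he⟩
end
end
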